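/- arXiv:1205.5985 — 3 statements merged into one kernel-verified Lean document; each statement's English description precedes it below -/
import Mathlib

section
/- Let (R,m) be a complete Cohen-Macaulay local ring of Krull dimension d > 0. Then the top local cohomology module H_m^d(R) has projective dimension pd_R H_m^d(R) = d; consequently, for any semidualizing R-module C, H_m^d(R) belongs to the Auslander class A_C(R) and Tor_i^R(C, H_m^d(R)) = 0 for all i ≥ 1. -/
/-!
Common definitions: semidualizing modules, `C`-injective modules and dimensions,
`G_C`-injective modules, Bass/Auslander classes, relative Cohen-Macaulayness,
Cohen-Macaulay and Gorenstein local rings, trivial extensions, ideal torsion.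
-/

noncomputable section

open CategoryTheory TensorProduct

universe u

variable (R : Type u) [CommRing R]

/-- An `R`-module `M` is `C`-injective if it is isomorphic to `Hom_R(C, I)`
for some injective `R`-module `I`. -/
def IsCInjective (C M : ModuleCat.{u} R) : Prop :=
  ∃ I : ModuleCat.{u} R, Module.Injective R I ∧ Nonempty (M ≃ₗ[R] (C →ₗ[R] I))

/-- `HasCoresDimLE R P n M` : the module `M` admits a coresolution of length at most `n`
by modules satisfying the property `P`. -/
def HasCoresDimLE (P : ModuleCat.{u} R → Prop) : ℕ → ModuleCat.{u} R → Prop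
  | 0, M => Subsingleton M ∨ P M
  | n + 1, M => Subsingleton M ∨ ∃ (X : ModuleCat.{u} R) (f : M →ₗ[R] X),
      P X ∧ Function.Injective f ∧
        HasCoresDimLE P n (ModuleCat.of R (X ⧸ LinearMap.range f))

/-- The coresolution dimension of `M` with respect to the class of modules satisfying `P`,
as an element of `ℕ∞` (`⊤` meaning no finite coresolution exists). -/
def coresDim (P : ModuleCat.{u} R → Prop) (M : ModuleCat.{u} R) : ℕ∞ :=
  sInf {d : ℕ∞ | ∃ n : ℕ, d = n ∧ HasCoresDimLE R P n M}

/-- The `C`-injective dimension of `M`. -/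
def cinjDim (C M : ModuleCat.{u} R) : ℕ∞ :=
  coresDim R (IsCInjective R C) M

/-- The injective dimension of `M`. -/
def injDim (M : ModuleCat.{u} R) : ℕ∞ :=
  coresDim R (fun N => Module.Injective R N) M

/-- A finitely generated `R`-module `C` is semidualizing if the natural map
`R → Hom_R(C,C)` is bijective and `Ext_R^i(C,C) = 0` for all `i ≥ 1`. -/
def IsSemidualizing (C : ModuleCat.{u} R) : Prop :=
  Module.Finite R C ∧ Function.Bijective (LinearMap.lsmul R C) ∧
    ∀ i : ℕ, 1 ≤ i →
      Subsingleton (((Ext R (ModuleCat.{u} R) i).obj (Opposite.op C)).obj C)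

/-- A dualizing module is a semidualizing module of finite injective dimension. -/
def IsDualizing (C : ModuleCat.{u} R) : Prop :=
  IsSemidualizing R C ∧ injDim R C ≠ ⊤

/-- A complete `I_C I`-resolution: an exact complex `Y` (with `d i : Y (i+1) → Y i`)
which stays exact after applying `Hom_R(I, -)` for every `C`-injective `I`, whose terms
in positive degrees are `C`-injective and whose terms in degrees `≤ 0` are injective. -/
structure CompleteICIResolution (C : ModuleCat.{u} R) where
  Y : ℤ → ModuleCat.{u} R
  d : (i : ℤ) → (Y (i + 1) →ₗ[R] Y i)
  exact : ∀ i : ℤ, Function.Exact (d (i + 1)) (d i)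
  cinj_pos : ∀ i : ℤ, 0 < i → IsCInjective R C (Y i)
  inj_nonpos : ∀ i : ℤ, i ≤ 0 → Module.Injective R (Y i)
  homExact : ∀ I : ModuleCat.{u} R, IsCInjective R C I → ∀ i : ℤ,
    Function.Exact (fun f : I →ₗ[R] Y (i + 1 + 1) => (d (i + 1)).comp f)
      (fun f : I →ₗ[R] Y (i + 1) => (d i).comp f)

/-- A module is `G_C`-injective if it is the kernel of the degree-`0` differential of some
complete `I_C I`-resolution. -/
def IsGCInjective (C M : ModuleCat.{u} R) : Prop :=
  ∃ res : CompleteICIResolution R C,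
    Nonempty (M ≃ₗ[R] ↥(LinearMap.ker (res.d (-1))))

/-- The `G_C`-injective dimension of `M`. -/
def gcinjDim (C M : ModuleCat.{u} R) : ℕ∞ :=
  coresDim R (IsGCInjective R C) M

/-- `M` is relative Cohen-Macaulay with respect to `a`: there is exactly one
non-vanishing local cohomology module of `M` with respect to `a`. -/
def IsRelativeCM (a : Ideal R) (M : ModuleCat.{u} R) : Prop :=
  ∃! n : ℕ, Nontrivial ((localCohomology a n).obj M)

/-- `M` is relative Cohen-Macaulay with respect to `a`, with (unique) non-vanishing
local cohomology in degree `n`. -/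
def IsRelativeCMAt (a : Ideal R) (n : ℕ) (M : ModuleCat.{u} R) : Prop :=
  Nontrivial ((localCohomology a n).obj M) ∧
    ∀ i : ℕ, i ≠ n → Subsingleton ((localCohomology a i).obj M)

/-- The cohomological dimension `cd(a, M)`: the largest `i` with `H_a^i(M) ≠ 0`. -/
def lcCohomDim (a : Ideal R) (M : ModuleCat.{u} R) : ℕ :=
  sSup {i : ℕ | Nontrivial ((localCohomology a i).obj M)}

/-- The grade `grade(a, M)`: the least `i` with `H_a^i(M) ≠ 0`. -/
def lcGrade (a : Ideal R) (M : ModuleCat.{u} R) : ℕ :=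
  sInf {i : ℕ | Nontrivial ((localCohomology a i).obj M)}

/-- A Noetherian local ring is Cohen-Macaulay iff `H_m^i(R) = 0` for all `i ≠ dim R`
(Grothendieck's characterization, taken here as the definition). -/
def IsCohenMacaulayLocalRing (S : Type u) [CommRing S] [IsLocalRing S] : Prop :=
  ∀ i : ℕ, (i : WithBot ℕ∞) ≠ ringKrullDim S →
    Subsingleton ((localCohomology (IsLocalRing.maximalIdeal S) i).obj (ModuleCat.of S S))

/-- A local ring is Gorenstein if it has finite injective dimension over itself. -/
def IsGorensteinLocalRing (S : Type u) [CommRing S] : Prop :=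
  injDim S (ModuleCat.of S S) ≠ ⊤

/-- The `a`-torsion submodule `Γ_a(M)` of `M`. -/
def idealTorsion (a : Ideal R) (M : Type u) [AddCommGroup M] [Module R M] :
    Submodule R M :=
  ⨆ n : ℕ, Submodule.torsionBySet R M ((a ^ n : Ideal R) : Set R)

/-- The Krull dimension of a module, `dim_S N = dim (S / ann_S N)`. -/
def moduleKrullDim (S : Type u) [CommRing S] (N : Type u) [AddCommGroup N] [Module S N] :
    WithBot ℕ∞ :=
  ringKrullDim (S ⧸ Module.annihilator S N)

/-- `ht_M(a) = inf { dim_{R_p} M_p  |  p ∈ Supp (M / a M) }`. -/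
def heightWRT (a : Ideal R) (M : Type u) [AddCommGroup M] [Module R M] : WithBot ℕ∞ :=
  ⨅ (p : PrimeSpectrum R) (_ : p ∈ Module.support R (M ⧸ (a • (⊤ : Submodule R M)))),
    moduleKrullDim (Localization.AtPrime p.asIdeal) (LocalizedModule p.asIdeal.primeCompl M)

/-- Membership in the Bass class `B_C(R)`. -/
def MemBassClass (C M : ModuleCat.{u} R) : Prop :=
  (∀ i : ℕ, 1 ≤ i →
      Subsingleton (((Ext R (ModuleCat.{u} R) i).obj (Opposite.op C)).obj M)) ∧
  (∀ i : ℕ, 1 ≤ i →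
      Subsingleton (((Tor (ModuleCat.{u} R) i).obj C).obj (ModuleCat.of R (C →ₗ[R] M)))) ∧
  Function.Bijective
    (TensorProduct.lift ((LinearMap.id : (C →ₗ[R] M) →ₗ[R] (C →ₗ[R] M)).flip))

/-- Membership in the Auslander class `A_C(R)`. -/
def MemAuslanderClass (C M : ModuleCat.{u} R) : Prop :=
  (∀ i : ℕ, 1 ≤ i →
      Subsingleton (((Tor (ModuleCat.{u} R) i).obj C).obj M)) ∧
  (∀ i : ℕ, 1 ≤ i →
      Subsingleton (((Ext R (ModuleCat.{u} R) i).obj (Opposite.op C)).obj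
        (ModuleCat.of R (↥C ⊗[R] ↥M)))) ∧
  Function.Bijective ((TensorProduct.mk R ↥C ↥M).flip)

/-- `HasResDimLE R P n M` : `M` admits a resolution of length at most `n`
by modules satisfying `P`. -/
def HasResDimLE (P : ModuleCat.{u} R → Prop) : ℕ → ModuleCat.{u} R → Prop
  | 0, M => Subsingleton M ∨ P M
  | n + 1, M => Subsingleton M ∨ ∃ (X : ModuleCat.{u} R) (f : X →ₗ[R] M),
      P X ∧ Function.Surjective f ∧
        HasResDimLE P n (ModuleCat.of R ↥(LinearMap.ker f))

/-- The projective dimension of `M`. -/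
def projDim (M : ModuleCat.{u} R) : ℕ∞ :=
  sInf {d : ℕ∞ | ∃ n : ℕ, d = n ∧ HasResDimLE R (fun N => Module.Projective R N) n M}

/-- The first projection of the trivial extension `R ⋉ C`, as a ring homomorphism. -/
def trivExtFst (C : Type u) [AddCommGroup C] [Module R C] [Module Rᵐᵒᵖ C]
    [IsCentralScalar R C] : TrivSqZeroExt R C →+* R where
  toFun := TrivSqZeroExt.fst
  map_one' := TrivSqZeroExt.fst_one (R := R) (M := C)
  map_mul' := TrivSqZeroExt.fst_mul
  map_zero' := TrivSqZeroExt.fst_zero (R := R) (M := C)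
  map_add' := TrivSqZeroExt.fst_add

/-- The ideal `a ⊕ C` of the trivial extension `R ⋉ C`. -/
def trivExtIdeal (a : Ideal R) (C : Type u) [AddCommGroup C] [Module R C] [Module Rᵐᵒᵖ C]
    [IsCentralScalar R C] : Ideal (TrivSqZeroExt R C) :=
  Ideal.comap (trivExtFst R C) a

/-- An `R`-module `M`, viewed as a module over the trivial extension `R ⋉ C` via the
natural surjection `R ⋉ C → R`. -/
def trivExtModuleCat (C : Type u) [AddCommGroup C] [Module R C] [Module Rᵐᵒᵖ C]
    [IsCentralScalar R C] (M : Type u) [AddCommGroup M] [Module R M] :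
    ModuleCat.{u} (TrivSqZeroExt R C) :=
  letI := Module.compHom M (trivExtFst R C)
  ModuleCat.of (TrivSqZeroExt R C) M

end

noncomputable section
universe u
open CategoryTheory TensorProduct Limits

section
variable {C : Type*} [Category* C] [Abelian C]

/-- The augmentation of a projective resolution. -/
def CategoryTheory.ProjectiveResolution.aug {Z : C} (Q : ProjectiveResolution Z) :
    Q.complex.X 0 ⟶ Z := Q.π.f 0

lemma CategoryTheory.ProjectiveResolution.d_aug {Z : C} (Q : ProjectiveResolution Z) :
    Q.complex.d 1 0 ≫ Q.aug = 0 := Q.complex_d_comp_π_f_zero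

instance {Z : C} (Q : ProjectiveResolution Z) : Epi Q.aug :=
  inferInstanceAs (Epi (Q.π.f 0))

lemma CategoryTheory.ProjectiveResolution.d_aug_exact {Z : C} (Q : ProjectiveResolution Z) :
    (ShortComplex.mk _ _ Q.d_aug).Exact := Q.exact₀

/-- Splicing a projective resolution of a syzygy. -/
def CategoryTheory.ProjectiveResolution.splice {S : ShortComplex C} (hS : S.ShortExact)
    [Projective S.X₂] (Q : ProjectiveResolution S.X₁) : ProjectiveResolution S.X₃ where
  complex := Q.complex.augment (Q.aug ≫ S.f) (by
    rw [← Category.assoc, Q.d_aug, zero_comp])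
  projective n := by
    cases n
    · dsimp; infer_instance
    · dsimp; infer_instance
  π := (ChainComplex.toSingle₀Equiv _ _).symm ⟨S.g, by
    change (Q.aug ≫ S.f) ≫ S.g = 0
    rw [Category.assoc, S.zero, comp_zero]⟩
  quasiIso := ⟨fun n => by
    have hf := hS.mono_f
    have hg := hS.epi_g
    have hπ : Epi (Q.aug) := inferInstance
    cases n with
    | zero =>
      rw [ChainComplex.quasiIsoAt₀_iff, ShortComplex.quasiIso_iff_of_zeros']
      · let T : ShortComplex C := .mk (Q.aug ≫ S.f) S.g (by
          rw [Category.assoc, S.zero, comp_zero])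
        let φ : T ⟶ S :=
          { τ₁ := Q.aug
            τ₂ := 𝟙 _
            τ₃ := 𝟙 _
            comm₁₂ := by simp [T]
            comm₂₃ := by simp [T] }
        have : Epi φ.τ₁ := hπ
        have : IsIso φ.τ₂ := inferInstanceAs (IsIso (𝟙 _))
        have : Mono φ.τ₃ := inferInstanceAs (Mono (𝟙 _))
        have hT : T.Exact := (ShortComplex.exact_iff_of_epi_of_isIso_of_mono φ).2 hS.exact
        have key : ∀ (b : S.X₂ ⟶ S.X₃) (w : (Q.aug ≫ S.f) ≫ b = 0), b = S.g →
            (ShortComplex.mk (Q.aug ≫ S.f) b w).Exact ∧ Epi b := by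
          rintro b w rfl
          exact ⟨hT, hg⟩
        exact key _ _ (ChainComplex.toSingle₀Equiv_symm_apply_f_zero _ _)
      all_goals rfl
    | succ n =>
      rw [quasiIsoAt_iff_exactAt']
      · rw [HomologicalComplex.exactAt_iff' _ (n + 1 + 1) (n + 1) n (by simp) (by simp)]
        cases n with
        | zero =>
          let T : ShortComplex C := .mk (Q.complex.d 1 0) (Q.aug ≫ S.f) (by
            rw [← Category.assoc, Q.d_aug, zero_comp])
          let φ : ShortComplex.mk _ _ Q.d_aug ⟶ T :=
            { τ₁ := 𝟙 _
              τ₂ := 𝟙 _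
              τ₃ := S.f
              comm₁₂ := by simp [T]
              comm₂₃ := by simp [T] }
          have : Epi φ.τ₁ := inferInstanceAs (Epi (𝟙 _))
          have : IsIso φ.τ₂ := inferInstanceAs (IsIso (𝟙 _))
          have : Mono φ.τ₃ := hf
          have hT : T.Exact := (ShortComplex.exact_iff_of_epi_of_isIso_of_mono φ).1 Q.d_aug_exact
          exact hT
        | succ n => exact Q.exact_succ n
      · apply ChainComplex.exactAt_succ_single_obj⟩

variable [EnoughProjectives C] {D : Type*} [Category* D] [Abelian D]

lemma CategoryTheory.ProjectiveResolution.isZero_leftDerived_obj_iff (F : C ⥤ D) [F.Additive]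
    {X : C} (P : ProjectiveResolution X) (n : ℕ) :
    IsZero ((F.leftDerived (n + 1)).obj X) ↔
      (ShortComplex.mk (F.map (P.complex.d (n + 2) (n + 1))) (F.map (P.complex.d (n + 1) n))
        (by rw [← F.map_comp, P.complex.d_comp_d, F.map_zero])).Exact := by
  rw [(P.isoLeftDerivedObj F (n + 1)).isZero_iff]
  refine (HomologicalComplex.exactAt_iff_isZero_homology _ _).symm.trans ?_
  rw [HomologicalComplex.exactAt_iff' _ (n + 2) (n + 1) n (by simp) (by simp)]
  rfl

lemma CategoryTheory.Functor.isZero_leftDerived_obj_of_shortExact (F : C ⥤ D) [F.Additive]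
    [PreservesFiniteColimits F] {S : ShortComplex C} (hS : S.ShortExact) [Projective S.X₂]
    [Mono (F.map S.f)] (h : ∀ n : ℕ, IsZero ((F.leftDerived (n + 1)).obj S.X₁)) (n : ℕ) :
    IsZero ((F.leftDerived (n + 1)).obj S.X₃) := by
  have hf := hS.mono_f
  let Q := projectiveResolution S.X₁
  rw [(Q.splice hS).isZero_leftDerived_obj_iff F]
  cases n with
  | succ n => exact (Q.isZero_leftDerived_obj_iff F n).1 (h n)
  | zero =>
    let T₀ : ShortComplex C := ShortComplex.mk _ _ Q.d_aug
    have hT₀ : (T₀.map F).Exact :=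
      by
      have key : ∀ S : ShortComplex C, S.Exact ∧ Epi S.g → (S.map F).Exact ∧ Epi (F.map S.g) :=
        ((Functor.preservesFiniteColimits_tfae F).out 3 1).1 ‹_›
      exact (key T₀ ⟨Q.d_aug_exact, inferInstanceAs (Epi Q.aug)⟩).1
    let T : ShortComplex D := .mk (F.map (Q.complex.d 1 0)) (F.map (Q.aug ≫ S.f)) (by
        rw [← F.map_comp, ← Category.assoc, Q.d_aug, zero_comp, F.map_zero])
    let φ : T₀.map F ⟶ T :=
            { τ₁ := 𝟙 _
              τ₂ := 𝟙 _
              τ₃ := F.map S.f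
              comm₁₂ := (Category.id_comp _).trans (Category.comp_id _).symm
              comm₂₃ := (Category.id_comp _).trans (F.map_comp _ _) }
    have : Epi φ.τ₁ := inferInstanceAs (Epi (𝟙 _))
    have : IsIso φ.τ₂ := inferInstanceAs (IsIso (𝟙 _))
    have : Mono φ.τ₃ := ‹_›
    have hT : T.Exact := (ShortComplex.exact_iff_of_epi_of_isIso_of_mono φ).1 hT₀
    exact hT

end
end

noncomputable section
universe u
open CategoryTheory TensorProduct Limits

namespace ExtComparison

variable {R : Type u} [CommRing R] {N N' : ModuleCat.{u} R}

section
variable (P : ProjectiveResolution N) (P' : ProjectiveResolution N') (n : ℕ) (M : ModuleCat.{u} R)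

/-- The complex computing the derived functors of `Hom(-, M)`. -/
def cpx : ChainComplex (ModuleCat.{u} R)ᵒᵖ ℕ :=
  (((linearYoneda R (ModuleCat.{u} R)).obj M).rightOp.mapHomologicalComplex _).obj P.complex

/-- The module of degree `n` cocycles of `Hom(P, M)`. -/
def cocycles : ModuleCat.{u} R := ((cpx P M).opcycles n).unop

/-- The inclusion of cocycles. -/
def ι : cocycles P n M ⟶ ModuleCat.of R (P.complex.X n ⟶ M) := ((cpx P M).pOpcycles n).unop

/-- The derived functor computed by the resolution `P`. -/
def isoHomology :
    (((linearYoneda R (ModuleCat.{u} R)).obj M).rightOp.leftDerived n).obj N ≅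
      (cpx P M).homology n :=
  P.isoLeftDerivedObj ((linearYoneda R (ModuleCat.{u} R)).obj M).rightOp n

/-- The projection of cocycles to `Ext`. -/
def proj : cocycles P n M ⟶ ((Ext R (ModuleCat.{u} R) n).obj (Opposite.op N)).obj M :=
  ((cpx P M).homologyι n).unop ≫ (isoHomology P n M).hom.unop

lemma proj_surjective : Function.Surjective (proj P n M) := by
  rw [← ModuleCat.epi_iff_surjective]
  have : Epi ((cpx P M).homologyι n).unop :=
    by
    have : Mono ((cpx P M).homologyι n) := inferInstance
    exact unop_epi_of_mono _
  have h : Epi (isoHomology P n M).hom.unop := inferInstance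
  exact @epi_comp _ _ _ _ _ _ ‹_› _ h

lemma ι_injective : Function.Injective (ι P n M) := by
  rw [← ModuleCat.mono_iff_injective]
  exact inferInstanceAs (Mono ((cpx P M).pOpcycles n).unop)

lemma ι_exact : Function.Exact (ι P n M)
    (fun f : P.complex.X n ⟶ M => P.complex.d (n + 1) n ≫ f) := by
  have h := ShortComplex.exact_of_g_is_cokernel (.mk _ _ ((cpx P M).d_pOpcycles (n + 1) n))
    ((cpx P M).opcyclesIsCokernel (n + 1) n (by simp))
  have := h.unop
  rw [ShortComplex.ShortExact.moduleCat_exact_iff_function_exact] at this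
  exact this

lemma proj_exact {j : ℕ} (hj : (ComplexShape.down ℕ).next n = j) :
    Function.Exact ((cpx P M).fromOpcycles n j).unop.hom (proj P n M).hom := by
  have h := ShortComplex.exact_of_f_is_kernel (.mk _ _ ((cpx P M).homologyι_comp_fromOpcycles n j))
    ((cpx P M).homologyIsKernel n j hj)
  have := h.unop
  rw [ShortComplex.ShortExact.moduleCat_exact_iff_function_exact] at this
  intro z
  refine Iff.trans ?_ (this z)
  have : Mono (isoHomology P n M).hom.unop := inferInstance
  rw [ModuleCat.mono_iff_injective] at this
  exact map_eq_zero_iff _ this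


lemma ι_comp_d (z : cocycles P n M) : P.complex.d (n + 1) n ≫ (ι P n M) z = 0 :=
  (ι_exact P n M _).2 ⟨z, rfl⟩

lemma extMk_smul (r : R) {n : ℕ} (f : P.complex.X n ⟶ M) (hf : P.complex.d (n + 1) n ≫ f = 0) :
    P.extMk (r • f) (n + 1) rfl (by rw [Linear.comp_smul, hf, smul_zero]) =
      r • P.extMk f (n + 1) rfl hf := by
  have := P.extMk_comp_mk₀ f (n + 1) rfl hf (r • 𝟙 M)
  simp only [Linear.comp_smul, Category.comp_id] at this
  rw [← this, Abelian.Ext.mk₀_smul, Abelian.Ext.comp_smul, Abelian.Ext.comp_mk₀_id]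

/-- The class in `Abelian.Ext` of a cocycle. -/
def cls : cocycles P n M →ₗ[R] Abelian.Ext N M n where
  toFun z := P.extMk ((ι P n M) z) (n + 1) rfl (ι_comp_d P n M z)
  map_add' z w := by
    rw [P.add_extMk]
    congr 1
    exact (ι P n M).hom.map_add z w
  map_smul' r z := by
    dsimp only [RingHom.id_apply]
    rw [← extMk_smul]
    congr 1
    exact (ι P n M).hom.map_smul r z

lemma cls_surjective : Function.Surjective (cls P n M) := fun α => by
  obtain ⟨f, hf, rfl⟩ := P.extMk_surjective α (n + 1) rfl
  obtain ⟨z, rfl⟩ := (ι_exact P n M f).1 hf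
  exact ⟨z, rfl⟩

open CochainComplex HomComplex in
lemma extMk_zero_eq_zero_iff (f : P.complex.X 0 ⟶ M) (hf : P.complex.d 1 0 ≫ f = 0) :
    P.extMk f 1 rfl hf = 0 ↔ f = 0 := by
  simp only [← P.extEquivCohomologyClass.apply_eq_iff_eq,
    ProjectiveResolution.extEquivCohomologyClass_extMk,
    ProjectiveResolution.extEquivCohomologyClass_zero,
    CohomologyClass.mk_eq_zero_iff]
  rw [Cocycle.toSingleMk_mem_coboundaries_iff _ _ _ _ _ 1 (by lia)]
  refine ⟨fun ⟨g, hg⟩ => ?_, ?_⟩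
  · have : IsZero (P.cochainComplex.X 1) := by
      exact P.cochainComplex.isZero_of_isStrictlyLE 0 1 (by lia)
    rw [this.eq_of_src g 0, comp_zero] at hg
    rw [← cancel_epi (P.cochainComplexXIso (-0) 0 rfl).hom, comp_zero]
    exact hg.symm
  · rintro rfl
    exact ⟨0, by simp⟩

lemma cls_eq_zero_iff (z : cocycles P n M) : cls P n M z = 0 ↔ proj P n M z = 0 := by
  cases n with
  | zero =>
    refine (extMk_zero_eq_zero_iff P M _ (ι_comp_d P 0 M z)).trans ?_
    refine Iff.trans ?_ (proj_exact P 0 M (j := 0) (by simp) z).symm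
    rw [HomologicalComplex.fromOpcycles_eq_zero _ (by simp)]
    rw [map_eq_zero_iff _ (ι_injective P 0 M)]
    refine ⟨?_, ?_⟩
    · rintro rfl
      exact ⟨0, rfl⟩
    · rintro ⟨w, rfl⟩
      rfl
  | succ n =>
    refine (P.extMk_eq_zero_iff _ (n + 1 + 1) rfl (ι_comp_d P (n + 1) M z) n rfl).trans ?_
    refine Iff.trans ?_ (proj_exact P (n + 1) M (j := n) (by simp) z).symm
    have key (g : P.complex.X n ⟶ M) :
      ι P (n + 1) M (((cpx P M).fromOpcycles (n + 1) n).unop.hom g) =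
        P.complex.d (n + 1) n ≫ g := 
      congr($(congr(($((cpx P M).p_fromOpcycles (n + 1) n)).unop.hom)) g)
    refine exists_congr fun g => ?_
    rw [← key]
    exact (ι_injective P (n + 1) M).eq_iff

/-- Comparison between the two versions of `Ext`. -/
def compare : ((Ext R (ModuleCat.{u} R) n).obj (Opposite.op N)).obj M →ₗ[R] Abelian.Ext N M n :=
  (LinearMap.ker (proj P n M).hom).liftQ (cls P n M)
      (fun z hz => (cls_eq_zero_iff P n M z).2 hz) ∘ₗ
    ((proj P n M).hom.quotKerEquivOfSurjective (proj_surjective P n M)).symm.toLinearMap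

lemma compare_proj (z : cocycles P n M) : compare P n M (proj P n M z) = cls P n M z := by
  have : ((proj P n M).hom.quotKerEquivOfSurjective (proj_surjective P n M)).symm
    (proj P n M z) = Submodule.Quotient.mk z := by
    rw [LinearEquiv.symm_apply_eq]
    rfl
  dsimp [compare]
  rw [this]
  rfl

lemma compare_bijective : Function.Bijective (compare P n M) := by
  constructor
  · rw [injective_iff_map_eq_zero]
    intro x hx
    obtain ⟨z, rfl⟩ := proj_surjective P n M x
    rw [compare_proj] at hx
    exact (cls_eq_zero_iff P n M z).1 hx
  · intro α
    obtain ⟨z, rfl⟩ := cls_surjective P n M α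
    exact ⟨_, compare_proj P n M z⟩

variable {P P'}

lemma compare_naturality {g : N ⟶ N'} (φ : ProjectiveResolution.Hom P P' g)
    (x : ((Ext R (ModuleCat.{u} R) n).obj (Opposite.op N')).obj M) :
    compare P n M ((((Ext R (ModuleCat.{u} R) n).map g.op).app M) x) =
      (Abelian.Ext.mk₀ g).comp (compare P' n M x) (zero_add n) := by
  obtain ⟨z, rfl⟩ := proj_surjective P' n M x
  let F := ((linearYoneda R (ModuleCat.{u} R)).obj M).rightOp
  let ψ : cpx P M ⟶ cpx P' M := (F.mapHomologicalComplex _).map φ.hom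
  let θ : cocycles P' n M ⟶ cocycles P n M := (HomologicalComplex.opcyclesMap ψ n).unop
  have h₁ : θ ≫ ι P n M = ι P' n M ≫ (F.map (φ.hom.f n)).unop :=
    congr(($(HomologicalComplex.p_opcyclesMap ψ n)).unop)
  have h₂ : proj P' n M ≫ ((Ext R (ModuleCat.{u} R) n).map g.op).app M = θ ≫ proj P n M := by
    have e₁ := HomologicalComplex.homologyι_naturality ψ n
    have e₂ : (F.leftDerived n).map g ≫ (isoHomology P' n M).hom =
        (isoHomology P n M).hom ≫ HomologicalComplex.homologyMap ψ n :=
      ProjectiveResolution.isoLeftDerivedObj_hom_naturality g P P' φ.hom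
        φ.hom_f_zero_comp_π_f_zero F n
    have e : (F.leftDerived n).map g ≫ (isoHomology P' n M).hom ≫ (cpx P' M).homologyι n =
        ((isoHomology P n M).hom ≫ (cpx P M).homologyι n) ≫
          HomologicalComplex.opcyclesMap ψ n := by
      rw [← Category.assoc, e₂, Category.assoc, Category.assoc, e₁]
    exact congr(($e).unop)
  have h₃ : ((Ext R (ModuleCat.{u} R) n).map g.op).app M (proj P' n M z) = proj P n M (θ z) :=
    congr($(congr(($h₂).hom)) z)
  rw [h₃, compare_proj, compare_proj]
  have h₄ : ι P n M (θ z) = φ.hom.f n ≫ ι P' n M z := congr($(congr(($h₁).hom)) z)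
  refine Eq.trans ?_ (ProjectiveResolution.mk₀_comp_extMk _ (n + 1) rfl (ι_comp_d P' n M z) φ).symm
  dsimp only [cls, LinearMap.coe_mk, AddHom.coe_mk]
  congr 1

end

variable (R) in
/-- The canonical comparison between the two versions of `Ext`. -/
def comparison (N M : ModuleCat.{u} R) (n : ℕ) :
    ((Ext R (ModuleCat.{u} R) n).obj (Opposite.op N)).obj M ≃ₗ[R] Abelian.Ext N M n :=
  LinearEquiv.ofBijective _ (compare_bijective (projectiveResolution N) n M)

lemma comparison_naturality (g : N ⟶ N') (n : ℕ) (M : ModuleCat.{u} R)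
    (x : ((Ext R (ModuleCat.{u} R) n).obj (Opposite.op N')).obj M) :
    comparison R N M n ((((Ext R (ModuleCat.{u} R) n).map g.op).app M) x) =
      (Abelian.Ext.mk₀ g).comp (comparison R N' M n x) (zero_add n) :=
  compare_naturality n M
    (⟨ProjectiveResolution.lift g _ _, by
      have := congr(($(ProjectiveResolution.lift_commutes g (projectiveResolution N)
        (projectiveResolution N'))).f 0)
      exact this⟩ : ProjectiveResolution.Hom _ _ g) x

lemma subsingleton_ext_iff (N M : ModuleCat.{u} R) (n : ℕ) :
    Subsingleton (((Ext R (ModuleCat.{u} R) n).obj (Opposite.op N)).obj M) ↔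
      Subsingleton (Abelian.Ext N M n) :=
  (comparison R N M n).toEquiv.subsingleton_congr

end ExtComparison
end

noncomputable section
universe u
open CategoryTheory Limits

section ProjectiveDimension

variable {R : Type u} [CommRing R]

/-- The short complex attached to an exact pair of linear maps. -/
abbrev shortComplexOfExact {X Y Z : Type u} [AddCommGroup X] [AddCommGroup Y] [AddCommGroup Z]
    [Module R X] [Module R Y] [Module R Z] {f : X →ₗ[R] Y} {g : Y →ₗ[R] Z}
    (h : Function.Exact f g) : ShortComplex (ModuleCat.{u} R) :=
  ModuleCat.shortComplexOfCompEqZero f g h.linearMap_comp_eq_zero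

lemma shortExact_shortComplexOfExact {X Y Z : Type u} [AddCommGroup X] [AddCommGroup Y]
    [AddCommGroup Z] [Module R X] [Module R Y] [Module R Z] {f : X →ₗ[R] Y} {g : Y →ₗ[R] Z}
    (h : Function.Exact f g) (hf : Function.Injective f) (hg : Function.Surjective g) :
    (shortComplexOfExact h).ShortExact :=
  ModuleCat.shortComplex_shortExact (shortComplexOfExact h) h hf hg

lemma hasResDimLE_projective_iff (n : ℕ) (M : ModuleCat.{u} R) :
    HasResDimLE R (fun N => Module.Projective R N) n M ↔ HasProjectiveDimensionLE M n := by
  induction n generalizing M with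
  | zero =>
    rw [← projective_iff_hasProjectiveDimensionLE_zero, ← IsProjective.iff_projective]
    refine ⟨?_, Or.inr⟩
    rintro (h | h)
    · have : Subsingleton M := h
      exact ⟨0, fun m => Subsingleton.elim _ _⟩
    · exact h
  | succ n ih =>
    constructor
    · rintro (h | ⟨X, f, hX, hf, hK⟩)
      · have := (ModuleCat.isZero_of_subsingleton M).hasProjectiveDimensionLT_zero
        exact hasProjectiveDimensionLT_of_ge M 0 _ (by lia)
      · rw [ih] at hK
        have hX' : Projective X := (IsProjective.iff_projective X).1 hX
        exact ((LinearMap.shortExact_shortComplexKer hf).hasProjectiveDimensionLT_X₃_iff n hX').2 hK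
    · intro h
      refine Or.inr ⟨ModuleCat.of R (M →₀ R), Finsupp.linearCombination R id, ?_,
        Finsupp.linearCombination_id_surjective R M, ?_⟩
      · exact inferInstanceAs (Module.Projective R (M →₀ R))
      · rw [ih]
        have hX' : Projective (ModuleCat.of R (M →₀ R)) := 
          (IsProjective.iff_projective _).1 inferInstance
        exact ((LinearMap.shortExact_shortComplexKer
          (Finsupp.linearCombination_id_surjective R M)).hasProjectiveDimensionLT_X₃_iff n hX').1 h

lemma exact_finsupp_mapRange (ι : Type) {X Y Z : Type u} [AddCommGroup X] [AddCommGroup Y]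
    [AddCommGroup Z] [Module R X] [Module R Y] [Module R Z] {f : X →ₗ[R] Y} {g : Y →ₗ[R] Z}
    (h : Function.Exact f g) (hf : Function.Injective f) :
    Function.Exact (Finsupp.mapRange.linearMap f : (ι →₀ X) →ₗ[R] (ι →₀ Y))
      (Finsupp.mapRange.linearMap g : (ι →₀ Y) →ₗ[R] (ι →₀ Z)) := by
  rw [LinearMap.exact_iff] at h ⊢
  rw [Finsupp.ker_mapRange, Finsupp.range_mapRange_linearMap _ (LinearMap.ker_eq_bot.2 hf), h]

lemma shortExact_finsupp_mapRange (ι : Type) {X Y Z : Type u} [AddCommGroup X] [AddCommGroup Y]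
    [AddCommGroup Z] [Module R X] [Module R Y] [Module R Z] {f : X →ₗ[R] Y} {g : Y →ₗ[R] Z}
    (h : Function.Exact f g) (hf : Function.Injective f) (hg : Function.Surjective g) :
    (shortComplexOfExact (exact_finsupp_mapRange ι h hf)).ShortExact :=
  shortExact_shortComplexOfExact _ (Finsupp.mapRange_injective _ (map_zero _) hf)
    (Finsupp.mapRange_surjective _ (map_zero _) hg)

lemma hasProjectiveDimensionLE_finsupp (ι : Type) (n : ℕ) (M : ModuleCat.{u} R)
    [h : HasProjectiveDimensionLE M n] : HasProjectiveDimensionLE (ModuleCat.of R (ι →₀ M)) n := by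
  induction n generalizing M with
  | zero =>
    rw [← projective_iff_hasProjectiveDimensionLE_zero, ← IsProjective.iff_projective] at h ⊢
    classical
    exact Module.Projective.of_equiv (finsuppLequivDFinsupp R (ι := ι) (M := M)).symm
  | succ n ih =>
    have hM := Finsupp.linearCombination_id_surjective R M
    have hX' : Projective (ModuleCat.of R (M →₀ R)) :=
      (IsProjective.iff_projective _).1 inferInstance
    have := ((LinearMap.shortExact_shortComplexKer hM).hasProjectiveDimensionLT_X₃_iff n hX').1 h
    have hK := ih _ (h := this)
    have hS := shortExact_finsupp_mapRange ι (LinearMap.exact_subtype_ker_map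
      (Finsupp.linearCombination R (id : M → M))) (Submodule.injective_subtype _) hM
    have hX'' : Projective (ModuleCat.of R (ι →₀ (M →₀ R))) :=
      (IsProjective.iff_projective _).1 inferInstance
    exact (hS.hasProjectiveDimensionLT_X₃_iff n hX'').2 hK

end ProjectiveDimension

section Telescope

variable {R : Type u} [CommRing R] (x : R) (M : Type u) [AddCommGroup M] [Module R M]

/-- The localization of a module away from an element. -/
abbrev LocalizedAway : Type u := LocalizedModule (Submonoid.powers x) M

/-- The quotient `M_x / M`. -/
abbrev LocalizedAwayQuotient : Type u :=
  LocalizedAway x M ⧸ LinearMap.range (LocalizedModule.mkLinearMap (Submonoid.powers x) M)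

/-- The map with cokernel `M_x`. -/
def telescopeMap : (ℕ →₀ M) →ₗ[R] (ℕ →₀ M) :=
  Finsupp.lsum R fun n => Finsupp.lsingle n - Finsupp.lsingle (n + 1) ∘ₗ LinearMap.lsmul R M x

/-- Projection from the telescope to the localization. -/
def telescopeProj : (ℕ →₀ M) →ₗ[R] LocalizedAway x M :=
  Finsupp.lsum R fun n => LocalizedModule.divBy (⟨x ^ n, n, rfl⟩ : Submonoid.powers x) ∘ₗ
    LocalizedModule.mkLinearMap (Submonoid.powers x) M

variable {x M}

@[simp] lemma telescopeMap_single (n : ℕ) (m : M) :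
    telescopeMap x M (Finsupp.single n m) = .single n m - .single (n + 1) (x • m) := by
  simp [telescopeMap]

@[simp] lemma telescopeProj_single (n : ℕ) (m : M) :
    telescopeProj x M (Finsupp.single n m) =
      LocalizedModule.mk m (⟨x ^ n, n, rfl⟩ : Submonoid.powers x) := by
  rw [telescopeProj, Finsupp.lsum_single]
  simp [LocalizedModule.divBy_apply, LocalizedModule.liftOn_mk]

lemma telescopeMap_apply_zero (g : ℕ →₀ M) : telescopeMap x M g 0 = g 0 := by
  induction g using Finsupp.induction_linear with
  | zero => simp
  | add f g hf hg => simp [hf, hg]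
  | single n m => simp

lemma telescopeMap_apply_succ (g : ℕ →₀ M) (n : ℕ) :
    telescopeMap x M g (n + 1) = g (n + 1) - x • g n := by
  induction g using Finsupp.induction_linear with
  | zero => simp
  | add f g hf hg => simp [hf, hg]; abel
  | single k m => 
    simp [Finsupp.single_apply]

lemma telescopeMap_injective : Function.Injective (telescopeMap x M) := by
  rw [injective_iff_map_eq_zero]
  intro g hg
  ext n
  induction n with
  | zero => rw [← telescopeMap_apply_zero (x := x), hg]
  | succ n ih =>
    have := telescopeMap_apply_succ (x := x) g n
    rw [hg, ih] at this
    simpa using this.symm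

lemma telescopeProj_surjective : Function.Surjective (telescopeProj x M) := by
  intro y
  induction y using LocalizedModule.induction_on with
  | h m s =>
    obtain ⟨_, n, rfl⟩ := s
    exact ⟨.single n m, by simp⟩

lemma single_sub_single_mem_range_telescopeMap (n k : ℕ) (m : M) :
    Finsupp.single n m - Finsupp.single (n + k) (x ^ k • m) ∈
      LinearMap.range (telescopeMap x M) := by
  induction k with
  | zero => simp
  | succ k ih =>
    have h : Finsupp.single (n + k) (x ^ k • m) - Finsupp.single (n + k + 1) (x ^ (k + 1) • m) ∈
        LinearMap.range (telescopeMap x M) :=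
      ⟨.single (n + k) (x ^ k • m), by rw [telescopeMap_single, smul_smul, pow_succ']⟩
    simpa [add_assoc] using add_mem ih h

lemma exists_single_sub_mem_range_telescopeMap (g : ℕ →₀ M) :
    ∃ (n : ℕ) (m : M), g - Finsupp.single n m ∈ LinearMap.range (telescopeMap x M) := by
  induction g using Finsupp.induction_linear with
  | zero => exact ⟨0, 0, by simp⟩
  | single n m => exact ⟨n, m, by simp⟩
  | add f g hf hg =>
    obtain ⟨n, m, h⟩ := hf
    obtain ⟨n', m', h'⟩ := hg
    refine ⟨n + n', x ^ n' • m + x ^ n • m', ?_⟩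
    have h₁ := single_sub_single_mem_range_telescopeMap (x := x) n n' m
    have h₂ := single_sub_single_mem_range_telescopeMap (x := x) n' n m'
    rw [add_comm n' n] at h₂
    convert add_mem (add_mem h h') (add_mem h₁ h₂) using 1
    rw [Finsupp.single_add]
    abel

lemma telescope_exact (hx : IsSMulRegular M x) :
    Function.Exact (telescopeMap x M) (telescopeProj x M) := by
  have h₀ : telescopeProj x M ∘ₗ telescopeMap x M = 0 := by
    ext n m
    simp only [LinearMap.comp_apply, Finsupp.lsingle_apply, telescopeMap_single, map_sub,
      telescopeProj_single, LinearMap.zero_apply, sub_eq_zero]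
    rw [LocalizedModule.mk_eq]
    exact ⟨1, by simp [Submonoid.smul_def, smul_smul, pow_succ]⟩
  intro g
  refine ⟨fun hg => ?_, ?_⟩
  · obtain ⟨n, m, h⟩ := exists_single_sub_mem_range_telescopeMap (x := x) g
    have h₁ : telescopeProj x M (g - Finsupp.single n m) = 0 := by
      obtain ⟨w, hw⟩ := h
      rw [← hw]
      exact LinearMap.congr_fun h₀ w
    rw [map_sub, hg, zero_sub, neg_eq_zero, telescopeProj_single,
      ← LocalizedModule.zero_mk 1, LocalizedModule.mk_eq] at h₁
    obtain ⟨⟨_, k, rfl⟩, hk⟩ := h₁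
    have hm : m = 0 := by
      apply hx.pow k
      simpa [Submonoid.smul_def] using hk
    simpa [hm] using h
  · rintro ⟨w, rfl⟩
    exact LinearMap.congr_fun h₀ w

lemma hasProjectiveDimensionLE_localizedAway (hx : IsSMulRegular M x) (n : ℕ)
    [HasProjectiveDimensionLE (ModuleCat.of R M) n] :
    HasProjectiveDimensionLE (ModuleCat.of R (LocalizedAway x M)) (n + 1) := by
  have h := hasProjectiveDimensionLE_finsupp ℕ n (ModuleCat.of R M)
  exact (shortExact_shortComplexOfExact (telescope_exact hx) telescopeMap_injective
    telescopeProj_surjective).hasProjectiveDimensionLT_X₃ (n + 1) h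
      (hasProjectiveDimensionLT_of_ge _ (n + 1) _ (by lia))

lemma localizedAway_mkLinearMap_injective (hx : IsSMulRegular M x) :
    Function.Injective (LocalizedModule.mkLinearMap (Submonoid.powers x) M) := by
  rw [injective_iff_map_eq_zero]
  intro m hm
  obtain ⟨⟨_, k, rfl⟩, hk⟩ :=
    (IsLocalizedModule.eq_zero_iff (Submonoid.powers x) (LocalizedModule.mkLinearMap _ M)).1 hm
  apply hx.pow k
  simpa [Submonoid.smul_def] using hk

variable (x M) in
lemma localizedAwayQuotient_exact :
    Function.Exact (LocalizedModule.mkLinearMap (Submonoid.powers x) M)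
      (LinearMap.range (LocalizedModule.mkLinearMap (Submonoid.powers x) M)).mkQ := by
  rw [LinearMap.exact_iff, Submodule.ker_mkQ]

lemma localizedAwayQuotient_shortExact (hx : IsSMulRegular M x) :
    (shortComplexOfExact (localizedAwayQuotient_exact x M)).ShortExact :=
  shortExact_shortComplexOfExact _ (localizedAway_mkLinearMap_injective hx)
    (Submodule.mkQ_surjective _)

lemma hasProjectiveDimensionLE_localizedAwayQuotient (hx : IsSMulRegular M x) (n : ℕ)
    [h : HasProjectiveDimensionLE (ModuleCat.of R M) n] :
    HasProjectiveDimensionLE (ModuleCat.of R (LocalizedAwayQuotient x M)) (n + 1) :=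
  (localizedAwayQuotient_shortExact hx).hasProjectiveDimensionLT_X₃ (n + 1) h
    (hasProjectiveDimensionLE_localizedAway hx n)

end Telescope
end

noncomputable section
universe u
open CategoryTheory Limits

section ExtVanishing

variable {R : Type u} [CommRing R]

namespace ExtVanishing
open Abelian

lemma smul_eq_mk₀_comp {N M : ModuleCat.{u} R} {i : ℕ} (y : R) (e : Ext N M i) :
    y • e = (Ext.mk₀ (y • 𝟙 N)).comp e (zero_add i) := by
  rw [Ext.mk₀_smul, Ext.smul_comp, Ext.mk₀_id_comp]

lemma smul_eq_comp_mk₀' {N M : ModuleCat.{u} R} {i : ℕ} (y : R) (e : Ext N M i) :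
    y • e = e.comp (Ext.mk₀ (y • 𝟙 M)) (add_zero i) := by
  rw [Ext.mk₀_smul, Ext.comp_smul, Ext.comp_mk₀_id]

lemma isIso_smul_id {M : ModuleCat.{u} R} {y : R} (h : Function.Bijective (fun m : M => y • m)) :
    IsIso (y • 𝟙 M) := by
  rw [ConcreteCategory.isIso_iff_bijective]
  exact h

lemma smul_id_eq_zero {M : ModuleCat.{u} R} {y : R} (h : ∀ m : M, y • m = 0) :
    y • 𝟙 M = 0 := by
  ext m
  exact h m

variable {N M : ModuleCat.{u} R} {y : R}

lemma subsingleton_ext_of_bijective (hN : ∀ n : N, y • n = 0)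
    (hM : Function.Bijective (fun m : M => y • m)) (i : ℕ) : Subsingleton (Ext N M i) := by
  have := isIso_smul_id hM
  refine subsingleton_of_forall_eq 0 fun e => ?_
  have h : e.comp (Ext.mk₀ (y • 𝟙 M)) (add_zero i) = 0 := by
    rw [← smul_eq_comp_mk₀', smul_eq_mk₀_comp, smul_id_eq_zero hN, Ext.mk₀_zero, Ext.zero_comp]
  have h' := congr_arg (fun t => t.comp (Ext.mk₀ (inv (y • 𝟙 M))) (add_zero i)) h
  simpa [Ext.comp_assoc_of_third_deg_zero] using h'

lemma subsingleton_ext_of_bijective' (hN : ∀ n : N, y • n = 0)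
    (hM : Function.Bijective (fun m : M => y • m)) (i : ℕ) : Subsingleton (Ext M N i) := by
  have := isIso_smul_id hM
  refine subsingleton_of_forall_eq 0 fun e => ?_
  have h : (Ext.mk₀ (y • 𝟙 M)).comp e (zero_add i) = 0 := by
    rw [← smul_eq_mk₀_comp, smul_eq_comp_mk₀', smul_id_eq_zero hN, Ext.mk₀_zero, Ext.comp_zero]
  have h' : (Ext.mk₀ (inv (y • 𝟙 M))).comp ((Ext.mk₀ (y • 𝟙 M)).comp e (zero_add i))
      (zero_add i) = 0 := by rw [h, Ext.comp_zero]
  rwa [Ext.mk₀_comp_mk₀_assoc, IsIso.inv_hom_id, Ext.mk₀_id_comp] at h'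

variable {S : ShortComplex (ModuleCat.{u} R)} (hS : S.ShortExact)

lemma bijective_comp_extClass (h : ∀ i, Subsingleton (Ext N S.X₂ i)) (i : ℕ) :
    Function.Bijective (fun t : Ext N S.X₃ i => t.comp hS.extClass (rfl : i + 1 = i + 1)) := by
  constructor
  · have : Function.Injective (hS.extClass.postcomp N (rfl : i + 1 = i + 1)) := by
      rw [injective_iff_map_eq_zero]
      intro t ht
      obtain ⟨s, rfl⟩ := Ext.covariant_sequence_exact₃ N hS t rfl ht
      rw [Subsingleton.elim s 0, Ext.zero_comp]
    exact this
  · intro t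
    obtain ⟨s, hs⟩ := Ext.covariant_sequence_exact₁ N hS t (Subsingleton.elim _ _) rfl
    exact ⟨s, hs⟩

lemma injective_extClass_comp (h : ∀ i, Subsingleton (Ext S.X₂ N i)) (i : ℕ) :
    Function.Injective (fun t : Ext S.X₁ N i => hS.extClass.comp t (add_comm 1 i)) := by
  have : Function.Injective (hS.extClass.precomp N (add_comm 1 i)) := by
    rw [injective_iff_map_eq_zero]
    intro t ht
    obtain ⟨s, rfl⟩ := Ext.contravariant_sequence_exact₁ hS N t (add_comm 1 i) ht
    rw [Subsingleton.elim s 0, Ext.comp_zero]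
  exact this

end ExtVanishing

/-- A power of `I` kills `N`. -/
def IsKilledByPow (I : Ideal R) (N : Type u) [AddCommGroup N] [Module R N] : Prop :=
  ∃ n : ℕ, ∀ a ∈ I ^ n, ∀ x : N, a • x = 0

lemma bijective_smul_localizedAway (x : R) (M : Type u) [AddCommGroup M] [Module R M] (n : ℕ) :
    Function.Bijective (fun m : LocalizedAway x M => x ^ n • m) := by
  have := IsLocalizedModule.map_units (S := Submonoid.powers x)
    (LocalizedModule.mkLinearMap (Submonoid.powers x) M) ⟨x ^ n, n, rfl⟩
  exact (Module.End.isUnit_iff _).1 this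

end ExtVanishing
end

noncomputable section
universe u
open CategoryTheory Limits

section LocalCohomology

variable {R : Type u} [CommRing R]

instance preservesColimitsOfShape_forget_op_op :
    PreservesColimitsOfShape (ℕᵒᵖᵒᵖ) (forget (ModuleCat.{u} R)) := by
  have : PreservesFilteredColimitsOfSize.{0, 0} (forget (ModuleCat.{u} R)) :=
    preservesFilteredColimitsOfSize_shrink.{0, u, 0, u} _
  infer_instance

lemma exists_linearMap_of_isColimit {F : ℕᵒᵖᵒᵖ ⥤ ModuleCat.{u} R} {c : Cocone F} (hc : IsColimit c)
    (s : Cocone F) (hs : ∀ j, Function.Injective (s.ι.app j)) :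
    ∃ f : c.pt →ₗ[R] s.pt, Function.Injective f ∧
      ∀ y, y ∈ LinearMap.range f ↔ ∃ j x, s.ι.app j x = y := by
  have hf : ∀ j x, (hc.desc s).hom (c.ι.app j x) = s.ι.app j x := fun j x =>
    congr($(hc.fac s j) x)
  refine ⟨(hc.desc s).hom, ?_, fun y => ⟨?_, ?_⟩⟩
  · rw [injective_iff_map_eq_zero]
    intro z hz
    obtain ⟨j, x, rfl⟩ := Concrete.isColimit_exists_rep F hc z
    rw [hf] at hz
    have hx : x = 0 := hs j (hz.trans (map_zero _).symm)
    rw [hx, map_zero]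
  · rintro ⟨z, rfl⟩
    obtain ⟨j, x, rfl⟩ := Concrete.isColimit_exists_rep F hc z
    exact ⟨j, x, (hf j x).symm⟩
  · rintro ⟨j, x, rfl⟩
    exact ⟨c.ι.app j x, hf j x⟩

open Abelian

/-- A class `e` in `Ext H M j` representing `Ext N M (i + j)` as `Ext N H i`, for every
module `N` killed by a power of `I`. -/
def IsExtRepresenting (I : Ideal R) {H M : ModuleCat.{u} R} {j : ℕ} (e : Ext H M j) : Prop :=
  ∀ N : ModuleCat.{u} R, IsKilledByPow I N → ∀ (i k : ℕ) (h : i + j = k),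
    Function.Bijective (fun t : Ext N H i => t.comp e h)

namespace IsExtRepresenting

variable {I : Ideal R} {H M : ModuleCat.{u} R} {j : ℕ} {e : Ext H M j}

/-- The equivalence `Hom (N, H) ≃ Ext N M j` given by a representing class. -/
def homEquiv (he : IsExtRepresenting I e) {N : ModuleCat.{u} R} (hN : IsKilledByPow I N) :
    (N →ₗ[R] H) ≃ₗ[R] Ext N M j :=
  ModuleCat.homLinearEquiv.symm.trans (Ext.linearEquiv₀.symm.trans
    (LinearEquiv.ofBijective ((Ext.bilinearCompOfLinear R N H M 0 j j (zero_add j)).flip e)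
      (he N hN 0 j (zero_add j))))

/-- Elements of `Ext (R / J, M)` correspond to elements of `H` killed by `J`. -/
def evalOne (he : IsExtRepresenting I e) (J : Ideal R) (hJ : IsKilledByPow I (R ⧸ J)) :
    ((Ext R (ModuleCat.{u} R) j).obj (Opposite.op (ModuleCat.of R (R ⧸ J)))).obj M →ₗ[R] H :=
  LinearMap.applyₗ (1 : R ⧸ J) ∘ₗ
    ((ExtComparison.comparison R (ModuleCat.of R (R ⧸ J)) M j).trans
      (he.homEquiv (N := ModuleCat.of R (R ⧸ J)) hJ).symm).toLinearMap

lemma evalOne_injective (he : IsExtRepresenting I e) (J : Ideal R)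
    (hJ : IsKilledByPow I (R ⧸ J)) : Function.Injective (he.evalOne J hJ) := by
  refine Function.Injective.comp (g := fun f : (R ⧸ J) →ₗ[R] H => f 1) ?_ (LinearEquiv.injective _)
  intro f g hfg
  refine Submodule.linearMap_qext _ (LinearMap.ext_ring ?_)
  exact hfg

lemma mem_range_evalOne (he : IsExtRepresenting I e) (J : Ideal R)
    (hJ : IsKilledByPow I (R ⧸ J)) (y : H) :
    (∃ x, he.evalOne J hJ x = y) ↔ ∀ a ∈ J, a • y = 0 := by
  constructor
  · rintro ⟨x, rfl⟩ a ha
    let f : (R ⧸ J) →ₗ[R] H := (he.homEquiv (N := ModuleCat.of R (R ⧸ J)) hJ).symm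
      (ExtComparison.comparison R (ModuleCat.of R (R ⧸ J)) M j x)
    change a • f 1 = 0
    have ha' : a • (1 : R ⧸ J) = 0 := (Submodule.Quotient.mk_eq_zero J).2 (by simpa using ha)
    rw [← map_smul, ha', map_zero]
  · intro h
    refine ⟨((ExtComparison.comparison R (ModuleCat.of R (R ⧸ J)) M j).trans
      (he.homEquiv (N := ModuleCat.of R (R ⧸ J)) hJ).symm).symm
        (Submodule.liftQ J (LinearMap.toSpanSingleton R H y) (fun a ha => h a ha)), ?_⟩
    refine (congr_arg (fun f : (R ⧸ J) →ₗ[R] H => f 1) (LinearEquiv.apply_symm_apply _ _)).trans ?_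
    exact one_smul R y

lemma evalOne_mapQ (he : IsExtRepresenting I e) {J J' : Ideal R} (hJ : IsKilledByPow I (R ⧸ J))
    (hJ' : IsKilledByPow I (R ⧸ J')) (h : J' ≤ J) 
    (x : ((Ext R (ModuleCat.{u} R) j).obj (Opposite.op (ModuleCat.of R (R ⧸ J)))).obj M) :
    he.evalOne J' hJ' ((((Ext R (ModuleCat.{u} R) j).map
      (ModuleCat.ofHom (Submodule.mapQ J' J LinearMap.id h)).op).app M) x) =
        he.evalOne J hJ x := by
  let g : ModuleCat.of R (R ⧸ J') ⟶ ModuleCat.of R (R ⧸ J) :=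
    ModuleCat.ofHom (Submodule.mapQ J' J LinearMap.id h)
  let f : (R ⧸ J) →ₗ[R] H := (he.homEquiv (N := ModuleCat.of R (R ⧸ J)) hJ).symm
    (ExtComparison.comparison R (ModuleCat.of R (R ⧸ J)) M j x)
  have hf : (Ext.mk₀ (ModuleCat.ofHom f)).comp e (zero_add j) =
      ExtComparison.comparison R (ModuleCat.of R (R ⧸ J)) M j x :=
    LinearEquiv.apply_symm_apply (he.homEquiv (N := ModuleCat.of R (R ⧸ J)) hJ) _
  have key : (he.homEquiv (N := ModuleCat.of R (R ⧸ J')) hJ').symm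
      (ExtComparison.comparison R (ModuleCat.of R (R ⧸ J')) M j
        ((((Ext R (ModuleCat.{u} R) j).map g.op).app M) x)) =
      f ∘ₗ Submodule.mapQ J' J LinearMap.id h := by
    rw [LinearEquiv.symm_apply_eq, ExtComparison.comparison_naturality, ← hf,
      Ext.mk₀_comp_mk₀_assoc]
    rfl
  exact congr($key 1)

/-- The cocone over the diagram computing local cohomology with point `H`. -/
def cocone (he : IsExtRepresenting I e) (J : Ideal R)
    (hJ : ∀ n : ℕ, IsKilledByPow I (R ⧸ J ^ n)) :
    Cocone (localCohomology.diagram (localCohomology.idealPowersDiagram J) j ⋙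
      (evaluation _ _).obj M) where
  pt := H
  ι :=
    { app n := ModuleCat.ofHom (he.evalOne (J ^ n.unop.unop) (hJ _))
      naturality n m g := by
        ext x
        exact he.evalOne_mapQ (hJ _) (hJ _) (Ideal.pow_le_pow_right g.unop.unop.down.down) x }

lemma exists_linearMap_localCohomology (he : IsExtRepresenting I e) (J : Ideal R)
    (hJ : ∀ n : ℕ, IsKilledByPow I (R ⧸ J ^ n)) :
    ∃ f : (localCohomology J j).obj M →ₗ[R] H, Function.Injective f ∧
      ∀ y, y ∈ LinearMap.range f ↔ ∃ n : ℕ, ∀ a ∈ J ^ n, a • y = 0 := by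
  have := localCohomology.hasColimitDiagram.{u, 0} (localCohomology.idealPowersDiagram J) j
  obtain ⟨f, hf, hf'⟩ := exists_linearMap_of_isColimit
    (isColimitOfPreserves ((evaluation _ _).obj M) (colimit.isColimit
      (localCohomology.diagram (localCohomology.idealPowersDiagram J) j)))
    (he.cocone J hJ) (fun n => he.evalOne_injective _ _)
  refine ⟨f, hf, fun y => (hf' y).trans ?_⟩
  constructor
  · rintro ⟨n, x, rfl⟩
    exact ⟨n.unop.unop, (he.mem_range_evalOne _ (hJ _) _).1 ⟨x, rfl⟩⟩
  · rintro ⟨n, hn⟩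
    obtain ⟨x, hx⟩ := (he.mem_range_evalOne _ (hJ n) y).2 hn
    exact ⟨Opposite.op (Opposite.op n), x, hx⟩

end IsExtRepresenting

end LocalCohomology
end

noncomputable section
universe u
open CategoryTheory Limits Abelian IsLocalRing

section Stages

variable {R : Type u} [CommRing R]

lemma IsExtRepresenting.step {I : Ideal R} {H M : ModuleCat.{u} R} {j : ℕ} {e : Ext H M j}
    (he : IsExtRepresenting I e) {x : R} (hx : IsSMulRegular H x) :
    IsExtRepresenting (I ⊔ Ideal.span {x})
      ((localizedAwayQuotient_shortExact hx).extClass.comp e (add_comm 1 j)) := by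
  intro N ⟨n, hn⟩ i k hk
  have h₁ : ∀ y : N, x ^ n • y = 0 := hn _ (Ideal.pow_mem_pow
    (Ideal.mem_sup_right (Ideal.mem_span_singleton_self x)) n)
  have h₂ := ExtVanishing.bijective_comp_extClass (localizedAwayQuotient_shortExact hx) (N := N)
    (fun i => ExtVanishing.subsingleton_ext_of_bijective h₁
      (bijective_smul_localizedAway x H n) i) i
  have h₃ := he N ⟨n, fun a ha => hn a (Ideal.pow_right_mono le_sup_left n ha)⟩ (i + 1) k
    (by lia)
  convert h₃.comp h₂ using 2 with t
  exact (Ext.comp_assoc t _ e rfl (add_comm 1 j) (by lia)).symm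

lemma exists_pow_sup_span_smul_eq_zero {I : Ideal R} {H : Type u} [AddCommGroup H] [Module R H]
    (hH : ∀ h : H, ∃ n : ℕ, ∀ a ∈ I ^ n, a • h = 0) (x : R) (y : LocalizedAwayQuotient x H) :
    ∃ n : ℕ, ∀ a ∈ (I ⊔ Ideal.span {x}) ^ n, a • y = 0 := by
  obtain ⟨y, rfl⟩ := Submodule.mkQ_surjective _ y
  induction y using LocalizedModule.induction_on with
  | h m s =>
    obtain ⟨_, k, rfl⟩ := s
    obtain ⟨n, hn⟩ := hH m
    refine ⟨n + k, fun a ha => ?_⟩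
    obtain ⟨b, hb, c, hc, rfl⟩ := Submodule.mem_sup.1 (Ideal.sup_pow_add_le_pow_sup_pow ha)
    rw [Ideal.span_singleton_pow, Ideal.mem_span_singleton'] at hc
    obtain ⟨c, rfl⟩ := hc
    have h₁ : b • LocalizedModule.mk m (⟨x ^ k, k, rfl⟩ : Submonoid.powers x) = 0 := by
      rw [LocalizedModule.smul'_mk, hn b hb, LocalizedModule.zero_mk]
    have h₂ : x ^ k • LocalizedModule.mk m (⟨x ^ k, k, rfl⟩ : Submonoid.powers x) =
        LocalizedModule.mkLinearMap (Submonoid.powers x) H m := by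
      rw [LocalizedModule.smul'_mk]
      exact LocalizedModule.mk_cancel (⟨x ^ k, k, rfl⟩ : Submonoid.powers x) m
    rw [← map_smul, add_smul, h₁, zero_add, mul_smul, h₂, map_smul]
    exact smul_eq_zero_of_right _ ((Submodule.Quotient.mk_eq_zero _).2 ⟨m, rfl⟩)

variable [IsLocalRing R]

/-- The invariants of an inductive construction of local cohomology: `H` represents the
`j`-th local cohomology of `R` with support in `I`, which is generated by `j` elements in general
position. -/
structure IsStage (I : Ideal R) (H : ModuleCat.{u} R) {j : ℕ} (e : Ext H (ModuleCat.of R R) j) :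
    Prop where
  le : I ≤ maximalIdeal R
  representing : IsExtRepresenting I e
  torsion : ∀ h : H, ∃ n : ℕ, ∀ a ∈ I ^ n, a • h = 0
  projectiveDimension : HasProjectiveDimensionLE H j
  nontrivial : Nontrivial (Ext H (ModuleCat.of R (ResidueField R)) j)
  height : ∀ p : Ideal R, p.IsPrime → I ≤ p → (j : ℕ∞) ≤ p.height

namespace IsStage

lemma zero : IsStage (⊥ : Ideal R) (ModuleCat.of R R) (Ext.mk₀ (𝟙 (ModuleCat.of R R))) where
  le := bot_le
  representing N hN i k h := by
    obtain rfl : i = k := by lia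
    simp only [Ext.comp_mk₀_id]
    exact Function.bijective_id
  torsion h := ⟨1, fun a ha => by
    rw [pow_one, Ideal.mem_bot] at ha
    rw [ha, zero_smul]⟩
  projectiveDimension := by
    rw [← projective_iff_hasProjectiveDimensionLE_zero, ← IsProjective.iff_projective]
    exact inferInstanceAs (Module.Projective R R)
  nontrivial := by
    refine ((Ext.linearEquiv₀ (R := R)).trans ModuleCat.homLinearEquiv).toEquiv.nontrivial_congr.2
      ⟨Algebra.linearMap R (ResidueField R), 0, fun h => ?_⟩
    have := LinearMap.congr_fun h 1
    simp at this
  height p _ _ := by simp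

variable {I : Ideal R} {H : ModuleCat.{u} R} {j : ℕ} {e : Ext H (ModuleCat.of R R) j}

lemma step (hs : IsStage I H e) {x : R} (hxm : x ∈ maximalIdeal R) (hx : IsSMulRegular H x)
    (h : ∀ p : Ideal R, p.IsPrime → I ⊔ Ideal.span {x} ≤ p → ((j + 1 : ℕ) : ℕ∞) ≤ p.height) :
    IsStage (I ⊔ Ideal.span {x}) (ModuleCat.of R (LocalizedAwayQuotient x H))
      ((localizedAwayQuotient_shortExact hx).extClass.comp e (add_comm 1 j)) where
  le := sup_le hs.le ((Ideal.span_singleton_le_iff_mem _).2 hxm)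
  representing := hs.representing.step hx
  torsion := exists_pow_sup_span_smul_eq_zero hs.torsion x
  projectiveDimension :=
    hasProjectiveDimensionLE_localizedAwayQuotient (h := hs.projectiveDimension) hx j
  nontrivial := by
    have := hs.nontrivial
    refine (ExtVanishing.injective_extClass_comp (localizedAwayQuotient_shortExact hx)
      (N := ModuleCat.of R (ResidueField R)) (fun i =>
        ExtVanishing.subsingleton_ext_of_bijective' (y := x ^ 1) (fun k => ?_)
          (bijective_smul_localizedAway x H 1) i) j).nontrivial
    rw [pow_one]
    change x • (k : ResidueField R) = 0
    rw [Algebra.smul_def, ResidueField.algebraMap_eq, (residue_eq_zero_iff x).2 hxm, zero_mul]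
  height := h

end IsStage

end Stages
end

noncomputable section
universe u
open CategoryTheory Limits Abelian IsLocalRing

section Stages

variable {R : Type u} [CommRing R]

lemma isKilledByPow_quotient {I J : Ideal R} {n : ℕ} (h : I ^ n ≤ J) : IsKilledByPow I (R ⧸ J) := by
  refine ⟨n, fun a ha y => ?_⟩
  obtain ⟨y, rfl⟩ := Submodule.mkQ_surjective _ y
  rw [← map_smul]
  exact (Submodule.Quotient.mk_eq_zero J).2 (J.mul_mem_right y (h ha))

lemma finite_associatedPrimes_of_torsion [IsNoetherianRing R] {I : Ideal R} {H : Type u}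
    [AddCommGroup H] [Module R H] [Module.Finite R ((R ⧸ I) →ₗ[R] H)]
    (h : ∀ y : H, ∃ n : ℕ, ∀ a ∈ I ^ n, a • y = 0) : (associatedPrimes R H).Finite := by
  refine (associatedPrimes.finite R ((R ⧸ I) →ₗ[R] H)).subset fun p hp => ?_
  rw [AssociatedPrimes.mem_iff, isAssociatedPrime_iff] at hp ⊢
  obtain ⟨hp, y, hy⟩ := hp
  refine ⟨hp, ?_⟩
  obtain ⟨n, hn⟩ := h y
  have hy' : ∀ a, a ∈ p ↔ a • y = 0 := fun a => by
    rw [hy, Submodule.mem_colon_singleton, Submodule.mem_bot]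
  have hI : I ≤ p := hp.le_of_pow_le (n := n) fun a ha => (hy' a).2 (hn a ha)
  refine ⟨Submodule.liftQ I (LinearMap.toSpanSingleton R H y) fun a ha => (hy' a).1 (hI ha), ?_⟩
  ext a
  rw [hy', Submodule.mem_colon_singleton, Submodule.mem_bot]
  constructor
  · intro ha
    refine Submodule.linearMap_qext _ (LinearMap.ext_ring ?_)
    exact (congr_arg (a • ·) (one_smul R y)).trans ha
  · intro ha
    exact (congr_arg (a • ·) (one_smul R y)).symm.trans
      (LinearMap.congr_fun ha (Submodule.Quotient.mk 1))

variable [IsLocalRing R]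

namespace IsStage

variable {I : Ideal R} {H : ModuleCat.{u} R} {j : ℕ} {e : Ext H (ModuleCat.of R R) j}

lemma exists_linearMap_localCohomology (hs : IsStage I H e) :
    ∃ f : (localCohomology (maximalIdeal R) j).obj (ModuleCat.of R R) →ₗ[R] H,
      Function.Injective f ∧
      ∀ y, y ∈ LinearMap.range f ↔ ∃ n : ℕ, ∀ a ∈ maximalIdeal R ^ n, a • y = 0 :=
  hs.representing.exists_linearMap_localCohomology _ fun n =>
    isKilledByPow_quotient (Ideal.pow_right_mono hs.le n)

variable [IsNoetherianRing R]

lemma maximalIdeal_notMem_associatedPrimes (hs : IsStage I H e)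
    (h : Subsingleton ((localCohomology (maximalIdeal R) j).obj (ModuleCat.of R R))) :
    maximalIdeal R ∉ associatedPrimes R H := by
  intro hm
  rw [AssociatedPrimes.mem_iff, isAssociatedPrime_iff] at hm
  obtain ⟨hm, y, hy⟩ := hm
  obtain ⟨f, -, hf⟩ := hs.exists_linearMap_localCohomology
  obtain ⟨z, hz⟩ := (hf y).2 ⟨1, fun a ha => by
    rwa [pow_one, hy, Submodule.mem_colon_singleton, Submodule.mem_bot] at ha⟩
  rw [Subsingleton.elim z 0, map_zero] at hz
  apply hm.ne_top
  rw [hy, ← hz]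
  simp

lemma finite_associatedPrimes (hs : IsStage I H e) : (associatedPrimes R H).Finite := by
  have : Module.Finite R ((R ⧸ I) →ₗ[R] H) :=
    Module.Finite.equiv (hs.representing.homEquiv (N := ModuleCat.of R (R ⧸ I))
      (isKilledByPow_quotient (n := 1) (pow_one I).le)).symm
  exact finite_associatedPrimes_of_torsion hs.torsion

lemma exists_element (hs : IsStage I H e)
    (h : Subsingleton ((localCohomology (maximalIdeal R) j).obj (ModuleCat.of R R)))
    (hj : ((j + 1 : ℕ) : ℕ∞) ≤ (maximalIdeal R).height) :
    ∃ x ∈ maximalIdeal R, IsSMulRegular H x ∧ ∀ p : Ideal R, p.IsPrime →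
      I ⊔ Ideal.span {x} ≤ p → ((j + 1 : ℕ) : ℕ∞) ≤ p.height := by
  let s : Set (Ideal R) := associatedPrimes R H ∪ (I.minimalPrimes \ {maximalIdeal R})
  have hsfin : s.Finite := hs.finite_associatedPrimes.union
    ((I.finite_minimalPrimes_of_isNoetherianRing R).subset Set.sdiff_subset)
  have hsprime : ∀ p ∈ s, p.IsPrime := by
    rintro p (hp | hp)
    · exact hp.isPrime
    · exact hp.1.1.1
  have hsm : ¬ ((maximalIdeal R : Ideal R) : Set R) ⊆ ⋃ p ∈ s, (p : Set R) := by
    intro hsub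
    obtain ⟨p, hp, hmp⟩ := (Ideal.subset_union_prime_finite hsfin (f := id) ⊥ ⊥
      (fun p hp _ _ => hsprime p hp)).1 hsub
    have hpm : p = maximalIdeal R := le_antisymm (le_maximalIdeal (hsprime p hp).ne_top) hmp
    subst hpm
    rcases hp with hp | hp
    · exact hs.maximalIdeal_notMem_associatedPrimes h hp
    · exact hp.2 rfl
  obtain ⟨x, hxm, hx⟩ := Set.not_subset.1 hsm
  simp only [Set.mem_iUnion, not_exists] at hx
  refine ⟨x, hxm, ?_, fun p hp hIp => ?_⟩
  · rw [isSMulRegular_iff_right_eq_zero_of_smul]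
    intro y hy
    by_contra hy0
    have : x ∈ ⋃ p ∈ associatedPrimes R H, (p : Set R) := by
      rw [biUnion_associatedPrimes_eq_zero_divisors]
      exact ⟨y, hy0, hy⟩
    simp only [Set.mem_iUnion] at this
    obtain ⟨p, hp, hxp⟩ := this
    exact hx p (Or.inl hp) hxp
  · obtain ⟨q, hq, hqp⟩ := Ideal.exists_minimalPrimes_le (le_sup_left.trans hIp)
    have hq' : q.IsPrime := hq.1.1
    by_cases hqm : q = maximalIdeal R
    · have : p = maximalIdeal R := le_antisymm (le_maximalIdeal hp.ne_top) (hqm ▸ hqp)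
      rwa [this]
    · have hqlt : q < p := lt_of_le_of_ne hqp fun heq => hx q (Or.inr ⟨hq, hqm⟩)
        (heq ▸ hIp (Ideal.mem_sup_right (Ideal.mem_span_singleton_self x)))
      have h₁ := Ideal.height_strict_mono_of_isPrime_of_isPrime hqlt
      have h₂ := hs.height q hq' hq.1.2
      push_cast
      exact (Order.add_one_le_of_lt (h₂.trans_lt h₁))

end IsStage

variable [IsNoetherianRing R]

lemma exists_isStage (hCM : IsCohenMacaulayLocalRing R) {d : ℕ}
    (hdim : ringKrullDim R = (d : WithBot ℕ∞)) (j : ℕ) (hj : j ≤ d) :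
    ∃ (I : Ideal R) (H : ModuleCat.{u} R) (e : Ext H (ModuleCat.of R R) j), IsStage I H e := by
  induction j with
  | zero => exact ⟨_, _, _, IsStage.zero⟩
  | succ j ih =>
    obtain ⟨I, H, e, hs⟩ := ih (by lia)
    have hht : (maximalIdeal R).height = d := by
      have := maximalIdeal_height_eq_ringKrullDim (R := R)
      rw [hdim] at this
      exact_mod_cast this
    obtain ⟨x, hxm, hx, hp⟩ := hs.exists_element (hCM j (by
      rw [hdim]
      exact_mod_cast (by lia : j ≠ d))) (by rw [hht]; exact_mod_cast hj)
    exact ⟨_, _, _, hs.step hxm hx hp⟩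

/-- The top local cohomology of a Cohen-Macaulay local ring of dimension `d` has projective
dimension at most `d` and a nonzero `d`-th extension group with the residue field. -/
lemma hasProjectiveDimensionLE_localCohomology (hCM : IsCohenMacaulayLocalRing R) {d : ℕ}
    (hdim : ringKrullDim R = (d : WithBot ℕ∞)) :
    HasProjectiveDimensionLE ((localCohomology (maximalIdeal R) d).obj (ModuleCat.of R R)) d ∧
      Nontrivial (Ext ((localCohomology (maximalIdeal R) d).obj (ModuleCat.of R R))
        (ModuleCat.of R (ResidueField R)) d) := by
  obtain ⟨I, H, e, hs⟩ := exists_isStage hCM hdim d le_rfl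
  have hht : (maximalIdeal R).height = d := by
    have := maximalIdeal_height_eq_ringKrullDim (R := R)
    rw [hdim] at this
    exact_mod_cast this
  have hrad : maximalIdeal R ≤ I.radical := by
    rw [Ideal.radical_eq_sInf]
    refine le_sInf fun p ⟨hIp, hp⟩ => ?_
    by_contra hmp
    have hlt : p < maximalIdeal R := lt_of_le_of_ne (le_maximalIdeal hp.ne_top)
      fun h => hmp h.ge
    have := (hs.height p hp hIp).trans_lt (Ideal.height_strict_mono_of_isPrime_of_isPrime hlt)
    rw [hht] at this
    exact lt_irrefl _ this
  obtain ⟨k, hk⟩ := Ideal.exists_pow_le_of_le_radical_of_fg hrad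
    (IsNoetherian.noetherian (maximalIdeal R))
  obtain ⟨f, hf, hf'⟩ := hs.exists_linearMap_localCohomology
  have hsurj : Function.Surjective f := fun y => (hf' y).2 <| by
    obtain ⟨n, hn⟩ := hs.torsion y
    exact ⟨k * n, fun a ha => hn a (Ideal.pow_right_mono hk n (by rwa [← pow_mul]))⟩
  have i : H ≅ (localCohomology (maximalIdeal R) d).obj (ModuleCat.of R R) :=
    (LinearEquiv.ofBijective f ⟨hf, hsurj⟩).symm.toModuleIso
  have := hs.projectiveDimension
  have := hs.nontrivial
  refine ⟨hasProjectiveDimensionLT_of_iso i _, ?_⟩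
  have hinj : Function.Injective (fun t : Ext H (ModuleCat.of R (ResidueField R)) d =>
      (Ext.mk₀ i.inv).comp t (zero_add d)) := by
    refine Function.LeftInverse.injective
      (g := fun t => (Ext.mk₀ i.hom).comp t (zero_add d)) fun t => ?_
    simp
  exact hinj.nontrivial

lemma projDim_localCohomology (hCM : IsCohenMacaulayLocalRing R) {d : ℕ}
    (hdim : ringKrullDim R = (d : WithBot ℕ∞)) :
    projDim R ((localCohomology (maximalIdeal R) d).obj (ModuleCat.of R R)) = d := by
  obtain ⟨h₁, h₂⟩ := hasProjectiveDimensionLE_localCohomology hCM hdim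
  apply le_antisymm
  · exact sInf_le ⟨d, rfl, (hasResDimLE_projective_iff _ _).2 h₁⟩
  · refine le_sInf ?_
    rintro _ ⟨n, rfl, hn⟩
    rw [hasResDimLE_projective_iff] at hn
    by_contra hlt
    have hlt' : n < d := by exact_mod_cast not_le.1 hlt
    obtain ⟨t, s, hts⟩ := h₂
    have h₃ := fun t => Ext.eq_zero_of_hasProjectiveDimensionLT
      (X := (localCohomology (maximalIdeal R) d).obj (ModuleCat.of R R))
      (Y := ModuleCat.of R (ResidueField R)) t (n + 1) (by lia : n + 1 ≤ d)
    exact hts ((h₃ t).trans (h₃ s).symm)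

end Stages
end

noncomputable section
universe u
open CategoryTheory Limits Abelian TensorProduct

section ExtFinsupp

variable {R : Type u} [CommRing R]

/-- The classes obtained from the components of a finitely supported family. -/
def componentClasses (N Y : ModuleCat.{u} R) (ι : Type u) (j : ℕ) :
    Set (Ext N (ModuleCat.of R (ι →₀ Y)) j) :=
  {t | ∃ (i : ι) (s : Ext N Y j),
    t = s.comp (Ext.mk₀ (ModuleCat.ofHom (Finsupp.lsingle i))) (add_zero j)}

lemma linearMap_finsupp_eq_sum {N Y : Type u} [AddCommGroup N] [Module R N] [AddCommGroup Y]
    [Module R Y] [Module.Finite R N] {ι : Type u} (f : N →ₗ[R] (ι →₀ Y)) :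
    ∃ s : Finset ι, f = ∑ i ∈ s, Finsupp.lsingle i ∘ₗ Finsupp.lapply i ∘ₗ f := by
  classical
  obtain ⟨S, hS⟩ := Module.Finite.fg_top (R := R) (M := N)
  refine ⟨S.biUnion fun n => (f n).support, LinearMap.ext_on hS fun n hn => ?_⟩
  ext i
  simp only [LinearMap.coe_sum, Finset.sum_apply, LinearMap.comp_apply, Finsupp.lsingle_apply,
    Finsupp.lapply_apply, Finsupp.finsetSum_apply, Finsupp.single_apply]
  rw [Finset.sum_ite_eq']
  split_ifs with h
  · rfl
  · simp only [Finset.mem_biUnion, not_exists, not_and, Finsupp.mem_support_iff, not_not] at h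
    exact h n hn

lemma mem_closure_componentClasses [IsNoetherianRing R] (N Y : ModuleCat.{u} R)
    [Module.Finite R N] (ι : Type u) (j : ℕ) (e : Ext N (ModuleCat.of R (ι →₀ Y)) j) :
    e ∈ AddSubgroup.closure (componentClasses N Y ι j) := by
  induction j generalizing N with
  | zero =>
    let θ : (N →ₗ[R] (ι →₀ Y)) ≃ₗ[R] Ext N (ModuleCat.of R (ι →₀ Y)) 0 :=
      (ModuleCat.homLinearEquiv (M := N) (N := ModuleCat.of R (ι →₀ Y))).symm.trans
        Ext.linearEquiv₀.symm
    obtain ⟨f, rfl⟩ := θ.surjective e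
    obtain ⟨s, hs⟩ := linearMap_finsupp_eq_sum f
    rw [hs, map_sum]
    refine AddSubgroup.sum_mem _ fun i _ => AddSubgroup.subset_closure
      ⟨i, Ext.mk₀ (ModuleCat.ofHom (Finsupp.lapply i ∘ₗ f)), ?_⟩
    rw [Ext.mk₀_comp_mk₀]
    rfl
  | succ j ih =>
    obtain ⟨n, f, hf⟩ := Module.Finite.exists_fin' R N
    have hS := LinearMap.shortExact_shortComplexKer hf
    have : Projective (ModuleCat.of R (Fin n → R)) :=
      (IsProjective.iff_projective _).1 inferInstance
    obtain ⟨e, rfl⟩ := precomp_extClass_surjective_of_projective_X₂ _ hS j e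
    induction ih (ModuleCat.of R (LinearMap.ker f)) e using AddSubgroup.closure_induction with
    | mem t ht =>
      obtain ⟨i, s, rfl⟩ := ht
      refine AddSubgroup.subset_closure ⟨i, hS.extClass.comp s (add_comm 1 j), ?_⟩
      exact (Ext.comp_assoc _ _ _ (add_comm 1 j) (add_zero j) (by lia)).symm
    | zero => rw [map_zero]; exact zero_mem _
    | add x y _ _ hx hy => rw [map_add]; exact add_mem hx hy
    | neg x _ hx => rw [map_neg]; exact neg_mem hx

lemma subsingleton_ext_finsupp [IsNoetherianRing R] (N Y : ModuleCat.{u} R) [Module.Finite R N]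
    (ι : Type u) (j : ℕ) [Subsingleton (Ext N Y j)] :
    Subsingleton (Ext N (ModuleCat.of R (ι →₀ Y)) j) := by
  refine subsingleton_of_forall_eq 0 fun e => ?_
  induction mem_closure_componentClasses N Y ι j e using AddSubgroup.closure_induction with
  | mem t ht =>
    obtain ⟨i, s, rfl⟩ := ht
    rw [Subsingleton.elim s 0, Ext.zero_comp]
  | zero => rfl
  | add x y _ _ hx hy => rw [hx, hy, add_zero]
  | neg x _ hx => rw [hx, neg_zero]

end ExtFinsupp

section Auslander

variable {R : Type u} [CommRing R]

variable (C : Type u) [AddCommGroup C] [Module R C]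

lemma mk_flip_naturality {M N : Type u} [AddCommGroup M] [Module R M] [AddCommGroup N] [Module R N]
    (f : M →ₗ[R] N) (m : M) : (TensorProduct.mk R C N).flip (f m) =
      f.lTensor C ∘ₗ (TensorProduct.mk R C M).flip m := by
  ext c
  simp

variable {C}

lemma mk_flip_bijective_finsupp [Module.Finite R C]
    (h : Function.Bijective (LinearMap.lsmul R C)) (ι : Type u) :
    Function.Bijective (TensorProduct.mk R C (ι →₀ R)).flip := by
  classical
  constructor
  · rw [injective_iff_map_eq_zero]
    intro f hf
    ext i
    apply h.1
    ext c
    have := congr(finsuppScalarRight R R C ι ($hf c) i)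
    simpa using this
  · intro g
    let φ : C →ₗ[R] (ι →₀ C) := (finsuppScalarRight R R C ι).toLinearMap ∘ₗ g
    obtain ⟨s, hs⟩ := linearMap_finsupp_eq_sum φ
    choose r hr using fun i => h.2 (Finsupp.lapply i ∘ₗ φ)
    refine ⟨∑ i ∈ s, Finsupp.single i (r i), ?_⟩
    ext c
    apply (finsuppScalarRight R R C ι).injective
    have h₁ := LinearMap.congr_fun hs c
    refine Eq.trans ?_ h₁.symm
    simp only [map_sum, LinearMap.coe_sum, Finset.sum_apply]
    refine Finset.sum_congr rfl fun i _ => ?_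
    have h₂ := LinearMap.congr_fun (hr i) c
    replace h₂ : r i • c = φ c i := h₂
    simp only [LinearMap.flip_apply, TensorProduct.mk_apply,
      finsuppScalarRight_apply_tmul, LinearMap.comp_apply, Finsupp.lapply_apply,
      Finsupp.lsingle_apply, Finsupp.sum_single_index, zero_smul, Finsupp.single_zero, h₂]

lemma mk_flip_bijective_of_retract {P F : Type u} [AddCommGroup P] [Module R P] [AddCommGroup F]
    [Module R F] {s : P →ₗ[R] F} {p : F →ₗ[R] P} (hps : p ∘ₗ s = LinearMap.id)
    (h : Function.Bijective (TensorProduct.mk R C F).flip) :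
    Function.Bijective (TensorProduct.mk R C P).flip := by
  constructor
  · intro x y hxy
    have h₁ : (TensorProduct.mk R C F).flip (s x) = (TensorProduct.mk R C F).flip (s y) := by
      rw [mk_flip_naturality, mk_flip_naturality, hxy]
    have h₂ := congr_arg p (h.1 h₁)
    rwa [← LinearMap.comp_apply, ← LinearMap.comp_apply, hps] at h₂
  · intro g
    obtain ⟨f, hf⟩ := h.2 (s.lTensor C ∘ₗ g)
    refine ⟨p f, ?_⟩
    rw [mk_flip_naturality, hf, ← LinearMap.comp_assoc, ← LinearMap.lTensor_comp, hps,
      LinearMap.lTensor_id, LinearMap.id_comp]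

lemma subsingleton_of_subsingleton_linearMap [IsNoetherianRing R] [Module.Finite R C]
    (hC : Function.Injective (LinearMap.lsmul R C)) {T : Type u} [AddCommGroup T] [Module R T]
    (h : Subsingleton (C →ₗ[R] T)) : Subsingleton T := by
  refine subsingleton_of_forall_eq 0 fun t => ?_
  have h' : Subsingleton (C →ₗ[R] (R ∙ t)) := ⟨fun f g => by
    ext c
    exact LinearMap.congr_fun (h.elim ((R ∙ t).subtype ∘ₗ f) ((R ∙ t).subtype ∘ₗ g)) c⟩
  obtain ⟨r, hr, hreg⟩ := IsSMulRegular.subsingleton_linearMap_iff.1 h'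
  have hr0 : r = 0 := by
    apply hC
    ext c
    simpa using Module.mem_annihilator.1 hr c
  have : (⟨t, Submodule.mem_span_singleton_self t⟩ : R ∙ t) = 0 := hreg (by simp [hr0])
  exact congr_arg Subtype.val this

end Auslander
end

noncomputable section
universe u
open CategoryTheory Limits Abelian TensorProduct

section AuslanderClass

variable {R : Type u} [CommRing R]

lemma subsingleton_ext_of_retract {N Y Z : ModuleCat.{u} R} {s : Y ⟶ Z} {p : Z ⟶ Y}
    (hsp : s ≫ p = 𝟙 Y) (n : ℕ) [Subsingleton (Ext N Z n)] : Subsingleton (Ext N Y n) := by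
  refine subsingleton_of_forall_eq 0 fun e => ?_
  rw [← Ext.comp_mk₀_id e, ← hsp, ← Ext.mk₀_comp_mk₀, ← Ext.comp_assoc_of_third_deg_zero,
    Subsingleton.elim (e.comp (Ext.mk₀ s) (add_zero n)) 0, Ext.zero_comp]

variable [IsNoetherianRing R] {C : ModuleCat.{u} R}

lemma IsSemidualizing.subsingleton_ext_tensorProduct (hC : IsSemidualizing R C)
    (P : Type u) [AddCommGroup P] [Module R P] [Module.Projective R P] (n : ℕ) :
    Subsingleton (Ext C (ModuleCat.of R (C ⊗[R] P)) (n + 1)) := by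
  classical
  have := hC.1
  have : Subsingleton (Ext C C (n + 1)) :=
    (ExtComparison.subsingleton_ext_iff C C (n + 1)).1 (hC.2.2 (n + 1) (by lia))
  have := subsingleton_ext_finsupp C C P (n + 1)
  obtain ⟨s, hs⟩ := Module.projective_def'.1 ‹Module.Projective R P›
  let e := finsuppScalarRight R R C P
  refine subsingleton_ext_of_retract (Z := ModuleCat.of R (P →₀ C))
    (s := ModuleCat.ofHom (e.toLinearMap ∘ₗ s.lTensor C))
    (p := ModuleCat.ofHom ((Finsupp.linearCombination R id).lTensor C ∘ₗ e.symm.toLinearMap))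
    ?_ (n + 1)
  refine ModuleCat.hom_ext (LinearMap.ext fun x => ?_)
  change (Finsupp.linearCombination R id).lTensor C (e.symm (e (s.lTensor C x))) = x
  rw [e.symm_apply_apply, ← LinearMap.lTensor_comp_apply, hs, LinearMap.lTensor_id,
    LinearMap.id_apply]

lemma IsSemidualizing.memAuslanderClass_of_projective (hC : IsSemidualizing R C)
    (P : ModuleCat.{u} R) [Module.Projective R P] : MemAuslanderClass R C P := by
  have := hC.1
  refine ⟨fun i hi => ?_, fun i hi => ?_, ?_⟩
  · obtain ⟨n, rfl⟩ := Nat.exists_eq_add_of_le' hi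
    have : Projective P := (IsProjective.iff_projective P).1 inferInstance
    exact ModuleCat.subsingleton_of_isZero (isZero_Tor_succ_of_projective _ C P n)
  · obtain ⟨n, rfl⟩ := Nat.exists_eq_add_of_le' hi
    exact (ExtComparison.subsingleton_ext_iff _ _ _).2 (hC.subsingleton_ext_tensorProduct P n)
  · obtain ⟨s, hs⟩ := Module.projective_def'.1 ‹Module.Projective R P›
    exact mk_flip_bijective_of_retract hs (mk_flip_bijective_finsupp hC.2.1 P)

/-- Tensoring with `C` preserves injectivity of maps between modules `N` for which
`N → Hom(C, C ⊗ N)` is bijective. -/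
lemma lTensor_injective_of_mk_flip_bijective [Module.Finite R C]
    (hC : Function.Injective (LinearMap.lsmul R C)) {K P : Type u} [AddCommGroup K] [Module R K]
    [AddCommGroup P] [Module R P] {f : K →ₗ[R] P} (hf : Function.Injective f)
    (hK : Function.Surjective (TensorProduct.mk R C K).flip)
    (hP : Function.Injective (TensorProduct.mk R C P).flip) :
    Function.Injective (f.lTensor C) := by
  have : Subsingleton (LinearMap.ker (f.lTensor C)) := by
    refine subsingleton_of_subsingleton_linearMap hC (subsingleton_of_forall_eq 0 fun g => ?_)
    obtain ⟨k, hk⟩ := hK ((LinearMap.ker (f.lTensor C)).subtype ∘ₗ g)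
    have hk0 : k = 0 := by
      apply hf
      apply hP
      rw [mk_flip_naturality, hk, map_zero, map_zero]
      ext c
      exact (g c).2
    ext c
    have := LinearMap.congr_fun hk c
    rw [hk0, map_zero] at this
    exact this.symm
  rwa [← LinearMap.ker_eq_bot, ← Submodule.subsingleton_iff_eq_bot]

lemma IsSemidualizing.memAuslanderClass_of_exact (hC : IsSemidualizing R C)
    {K P M : ModuleCat.{u} R} [Module.Projective R P] {f : K →ₗ[R] P} {g : P →ₗ[R] M}
    (hfg : Function.Exact f g) (hf : Function.Injective f) (hg : Function.Surjective g)
    (hK : MemAuslanderClass R C K) : MemAuslanderClass R C M := by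
  have := hC.1
  have hP := hC.memAuslanderClass_of_projective P
  have hf' : Function.Injective (f.lTensor C) :=
    lTensor_injective_of_mk_flip_bijective hC.2.1.1 hf hK.2.2.2 hP.2.2.1
  have hT := lTensor_exact C hfg hg
  have hg' := LinearMap.lTensor_surjective C hg
  have hS := shortExact_shortComplexOfExact hT hf' hg'
  have extK (n : ℕ) : Subsingleton (Ext C (ModuleCat.of R (C ⊗[R] K)) (n + 1)) :=
    (ExtComparison.subsingleton_ext_iff _ _ _).1 (hK.2.1 (n + 1) (by lia))
  refine ⟨fun i hi => ?_, fun i hi => ?_, ?_, ?_⟩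
  · obtain ⟨n, rfl⟩ := Nat.exists_eq_add_of_le' hi
    let F := (MonoidalCategory.tensoringLeft (ModuleCat.{u} R)).obj C
    have : Projective (shortComplexOfExact hfg).X₂ :=
      (IsProjective.iff_projective P).1 inferInstance
    have : Mono (F.map (shortComplexOfExact hfg).f) := (ModuleCat.mono_iff_injective _).2 hf'
    have : PreservesFiniteColimits F := inferInstance
    exact ModuleCat.subsingleton_of_isZero (F.isZero_leftDerived_obj_of_shortExact
      (shortExact_shortComplexOfExact hfg hf hg) (fun n =>
        have : Subsingleton ((F.leftDerived (n + 1)).obj (shortComplexOfExact hfg).X₁) :=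
          hK.1 (n + 1) (by lia)
        ModuleCat.isZero_of_subsingleton _) n)
  · obtain ⟨n, rfl⟩ := Nat.exists_eq_add_of_le' hi
    refine (ExtComparison.subsingleton_ext_iff _ _ _).2 (subsingleton_of_forall_eq 0 fun e => ?_)
    have := extK (n + 1)
    have := hC.subsingleton_ext_tensorProduct P n
    obtain ⟨t, rfl⟩ := Ext.covariant_sequence_exact₃ C hS e rfl
      (Subsingleton.elim (α := Ext C (ModuleCat.of R (C ⊗[R] K)) (n + 1 + 1)) _ _)
    rw [Subsingleton.elim (α := Ext C (ModuleCat.of R (C ⊗[R] P)) (n + 1)) t 0]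
    exact Ext.zero_comp ..
  · rw [injective_iff_map_eq_zero]
    intro m hm
    obtain ⟨p, rfl⟩ := hg m
    rw [mk_flip_naturality] at hm
    have hp (c : C) : c ⊗ₜ[R] p ∈ LinearMap.range (f.lTensor C) :=
      (hT _).1 (LinearMap.congr_fun hm c)
    obtain ⟨k, hk⟩ := hK.2.2.2 ((LinearEquiv.ofInjective _ hf').symm.toLinearMap ∘ₗ
      ((TensorProduct.mk R C P).flip p).codRestrict _ hp)
    suffices f k = p by rw [← this, hfg.apply_apply_eq_zero]
    apply hP.2.2.1
    rw [mk_flip_naturality, hk]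
    ext c
    exact congr_arg Subtype.val ((LinearEquiv.ofInjective _ hf').apply_symm_apply ⟨_, hp c⟩)
  · intro φ
    have := extK 0
    obtain ⟨t, ht⟩ := Ext.covariant_sequence_exact₃ C hS (Ext.mk₀ (ModuleCat.ofHom φ)) rfl
      (Subsingleton.elim (α := Ext C (ModuleCat.of R (C ⊗[R] K)) (0 + 1)) _ _)
    obtain ⟨t, rfl⟩ := (Ext.mk₀_bijective _ _).2 t
    rw [Ext.mk₀_comp_mk₀] at ht
    have ht := (Ext.mk₀_bijective _ _).1 ht
    obtain ⟨p, hp⟩ := hP.2.2.2 t.hom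
    refine ⟨g p, ?_⟩
    rw [mk_flip_naturality, hp]
    exact congr_arg ModuleCat.Hom.hom ht

lemma IsSemidualizing.memAuslanderClass_of_hasResDimLE (hC : IsSemidualizing R C) (n : ℕ)
    (M : ModuleCat.{u} R) (hM : HasResDimLE R (fun N => Module.Projective R N) n M) :
    MemAuslanderClass R C M := by
  induction n generalizing M with
  | zero =>
    obtain hM | hM := hM
    · have : Module.Projective R M := ⟨0, fun _ => Subsingleton.elim _ _⟩
      exact hC.memAuslanderClass_of_projective M
    · exact hC.memAuslanderClass_of_projective M
  | succ n ih =>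
    obtain hM | ⟨P, f, hP, hf, h⟩ := hM
    · have : Module.Projective R M := ⟨0, fun _ => Subsingleton.elim _ _⟩
      exact hC.memAuslanderClass_of_projective M
    · exact hC.memAuslanderClass_of_exact (K := ModuleCat.of R (LinearMap.ker f))
        (LinearMap.exact_subtype_ker_map f) (Submodule.subtype_injective _) hf (ih _ h)

end AuslanderClass
end

noncomputable section
open CategoryTheory TensorProduct

/-- For a complete Cohen-Macaulay local ring of dimension `d > 0`,
`pd_R H_m^d(R) = d`; consequently, for every semidualizing module `C`, `H_m^d(R)` lies in
the Auslander class `A_C(R)` and `Tor_i^R(C, H_m^d(R)) = 0` for all `i ≥ 1`. -/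
theorem stmt_15 (R : Type u) [CommRing R] [IsNoetherianRing R] [IsLocalRing R]
    [IsAdicComplete (IsLocalRing.maximalIdeal R) R]
    (hCM : IsCohenMacaulayLocalRing R) (d : ℕ)
    (hdim : ringKrullDim R = (d : WithBot ℕ∞)) (hd : 0 < d) :
    projDim R ((localCohomology (IsLocalRing.maximalIdeal R) d).obj (ModuleCat.of R R)) =
      (d : ℕ∞) ∧
    ∀ C : ModuleCat.{u} R, IsSemidualizing R C →
      MemAuslanderClass R C
        ((localCohomology (IsLocalRing.maximalIdeal R) d).obj (ModuleCat.of R R)) ∧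
      ∀ i : ℕ, 1 ≤ i →
        Subsingleton (((Tor (ModuleCat.{u} R) i).obj C).obj
          ((localCohomology (IsLocalRing.maximalIdeal R) d).obj (ModuleCat.of R R))) := by
  have hpd := (hasResDimLE_projective_iff d _).2
    (hasProjectiveDimensionLE_localCohomology hCM hdim).1
  refine ⟨projDim_localCohomology hCM hdim, fun C hC => ?_⟩
  have h := hC.memAuslanderClass_of_hasResDimLE d _ hpd
  exact ⟨h, h.1⟩

end
end

section
/- Let (R,m) be a Noetherian local ring and let a be an ideal of R such that R is relative Cohen-Macaulay with respect to a. Let C be a semidualizing R-module. Then, viewing R as a module over the trivial extension R ⋉ C via the natural surjection, H_a^i(R) ≅ H_{a ⊕ C}^i(R) as R ⋉ C-modules for all i, and R is relative Cohen-Macaulay with respect to the ideal a ⊕ C of R ⋉ C. -/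
noncomputable section
universe v u v' u'
open CategoryTheory Limits Opposite

namespace CategoryTheory

variable {A : Type u} [Category.{v} A] [Abelian A]
  {B : Type u'} [Category.{v'} B] [Abelian B]

/-- The complexes obtained by applying a short complex of additive functors to a complex. -/
def mapHomologicalShortComplex (S : ShortComplex (A ⥤ B)) [S.X₁.Additive] [S.X₂.Additive]
    [S.X₃.Additive] (K : ChainComplex A ℕ) : ShortComplex (ChainComplex B ℕ) where
  X₁ := (S.X₁.mapHomologicalComplex _).obj K
  X₂ := (S.X₂.mapHomologicalComplex _).obj K
  X₃ := (S.X₃.mapHomologicalComplex _).obj K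
  f := (NatTrans.mapHomologicalComplex S.f _).app K
  g := (NatTrans.mapHomologicalComplex S.g _).app K
  zero := by
    ext i
    exact congr_app S.zero (K.X i)

/-- The functoriality of `mapHomologicalShortComplex` in the complex. -/
def mapHomologicalShortComplexMap (S : ShortComplex (A ⥤ B)) [S.X₁.Additive] [S.X₂.Additive]
    [S.X₃.Additive] {K L : ChainComplex A ℕ} (φ : K ⟶ L) :
    mapHomologicalShortComplex S K ⟶ mapHomologicalShortComplex S L where
  τ₁ := (S.X₁.mapHomologicalComplex _).map φ
  τ₂ := (S.X₂.mapHomologicalComplex _).map φ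
  τ₃ := (S.X₃.mapHomologicalComplex _).map φ
  comm₁₂ := (NatTrans.mapHomologicalComplex S.f _).naturality φ
  comm₂₃ := (NatTrans.mapHomologicalComplex S.g _).naturality φ

/-- A short complex of functors is short exact on projective objects. -/
def ShortExactOnProjectives (S : ShortComplex (A ⥤ B)) : Prop :=
  ∀ P : A, Projective P → (S.map ((evaluation A B).obj P)).ShortExact

variable {S : ShortComplex (A ⥤ B)} [S.X₁.Additive] [S.X₂.Additive] [S.X₃.Additive]

lemma ShortExactOnProjectives.shortExact (hS : ShortExactOnProjectives S)
    (K : ChainComplex A ℕ) [∀ i, Projective (K.X i)] :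
    (mapHomologicalShortComplex S K).ShortExact :=
  HomologicalComplex.shortExact_of_degreewise_shortExact _ fun i => hS (K.X i) inferInstance

lemma exact_of_conj {X Y Z X' Y' Z' : B} (e : X ≅ X') (e' : Y ≅ Y') (e'' : Z ≅ Z')
    {f : X ⟶ Y} {g : Y ⟶ Z} {f' : X' ⟶ Y'} {g' : Y' ⟶ Z'} {w : f' ≫ g' = 0}
    (h : (ShortComplex.mk f' g' w).Exact)
    (hf : f = e.hom ≫ f' ≫ e'.inv) (hg : g = e'.hom ≫ g' ≫ e''.inv) :
    ∃ w, (ShortComplex.mk f g w).Exact := by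
  have w' : f ≫ g = 0 := by simp [hf, hg, reassoc_of% w]
  refine ⟨w', (ShortComplex.exact_iff_of_iso ?_).2 h⟩
  exact ShortComplex.isoMk e e' e'' (by simp [hf]) (by simp [hg])

/-- The long exact sequence of left derived functors induced by a sequence of functors
which is short exact on projective objects. -/
lemma exists_leftDerived_connecting [EnoughProjectives A] (hS : ShortExactOnProjectives S) (n : ℕ) :
    ∃ δ : S.X₃.leftDerived (n + 1) ⟶ S.X₁.leftDerived n,
      (∀ X, ∃ w, (ShortComplex.mk ((NatTrans.leftDerived S.g (n + 1)).app X) (δ.app X) w).Exact) ∧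
      (∀ X, ∃ w, (ShortComplex.mk (δ.app X) ((NatTrans.leftDerived S.f n).app X) w).Exact) := by
  let P : ∀ X : A, ProjectiveResolution X := fun X => projectiveResolution X
  have h := fun X => hS.shortExact (P X).complex
  have hr : (ComplexShape.down ℕ).Rel (n + 1) n := by simp
  let d (X : A) : (HomologicalComplex.homologyFunctor B _ (n + 1)).obj
        ((S.X₃.mapHomologicalComplex _).obj (P X).complex) ⟶
      (HomologicalComplex.homologyFunctor B _ n).obj
        ((S.X₁.mapHomologicalComplex _).obj (P X).complex) := (h X).δ (n + 1) n hr
  let δ : S.X₃.leftDerived (n + 1) ⟶ S.X₁.leftDerived n :=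
    { app := fun X => ((P X).isoLeftDerivedObj S.X₃ (n + 1)).hom ≫
        d X ≫ ((P X).isoLeftDerivedObj S.X₁ n).inv
      naturality := fun X Y f => by
        let φ := ProjectiveResolution.lift f (P X) (P Y)
        have comm : φ.f 0 ≫ (P Y).π.f 0 =
          (P X).π.f 0 ≫ f := ProjectiveResolution.lift_commutes_zero f (P X) (P Y)
        have hd : (S.X₃.mapHomologicalComplex _ ⋙
            HomologicalComplex.homologyFunctor B _ (n + 1)).map φ ≫ d Y =
          d X ≫ (S.X₁.mapHomologicalComplex _ ⋙
            HomologicalComplex.homologyFunctor B _ n).map φ :=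
          (HomologicalComplex.HomologySequence.δ_naturality
            (mapHomologicalShortComplexMap S φ) (h X) (h Y) (n + 1) n hr).symm
        rw [ProjectiveResolution.isoLeftDerivedObj_hom_naturality_assoc f (P X) (P Y) _ comm,
          reassoc_of% hd, Category.assoc, Category.assoc,
          ProjectiveResolution.isoLeftDerivedObj_inv_naturality f (P X) (P Y) _ comm]
        rfl }
  refine ⟨δ, fun X => ?_, fun X => ?_⟩
  · exact exact_of_conj _ _ _ ((h X).homology_exact₃ (n + 1) n hr)
      ((P X).leftDerived_app_eq _ _) rfl
  · exact exact_of_conj _ _ _ ((h X).homology_exact₁ (n + 1) n hr)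
      rfl ((P X).leftDerived_app_eq _ _)

end CategoryTheory

namespace CategoryTheory

variable {C : Type u} [Category.{v} C] [Abelian C] (R : Type u') [Ring R] [Linear R C]

/-- The short complex of functors `Cᵒᵖ`-valued Hom functors attached to a short complex. -/
def linearYonedaShortComplex (S : ShortComplex C) : ShortComplex (C ⥤ (ModuleCat.{v} R)ᵒᵖ) where
  X₁ := ((linearYoneda R C).obj S.X₃).rightOp
  X₂ := ((linearYoneda R C).obj S.X₂).rightOp
  X₃ := ((linearYoneda R C).obj S.X₁).rightOp
  f := NatTrans.rightOp ((linearYoneda R C).map S.g)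
  g := NatTrans.rightOp ((linearYoneda R C).map S.f)
  zero := by
    ext X
    refine Quiver.Hom.unop_inj ?_
    ext (x : X ⟶ S.X₁)
    exact (Category.assoc _ _ _).trans (by simp [S.zero]; rfl)

instance (S : ShortComplex C) : (linearYonedaShortComplex R S).X₁.Additive :=
  inferInstanceAs ((linearYoneda R C).obj S.X₃).rightOp.Additive
instance (S : ShortComplex C) : (linearYonedaShortComplex R S).X₂.Additive :=
  inferInstanceAs ((linearYoneda R C).obj S.X₂).rightOp.Additive
instance (S : ShortComplex C) : (linearYonedaShortComplex R S).X₃.Additive :=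
  inferInstanceAs ((linearYoneda R C).obj S.X₁).rightOp.Additive

lemma shortExactOnProjectives_linearYoneda {S : ShortComplex C} (hS : S.ShortExact) :
    ShortExactOnProjectives (linearYonedaShortComplex R S) := by
  intro P hP
  have := hS.mono_f
  have := hS.epi_g
  let T : ShortComplex (ModuleCat.{v} R) :=
    .mk (((linearYoneda R C).map S.f).app (op P)) (((linearYoneda R C).map S.g).app (op P)) (by
      ext (x : P ⟶ S.X₁)
      exact (Category.assoc _ _ _).trans (by simp [S.zero]; rfl))
  have hT : T.ShortExact := by
    refine ModuleCat.shortComplex_shortExact T ?_ ?_ ?_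
    · rw [← ShortComplex.ShortExact.moduleCat_exact_iff_function_exact, ShortComplex.moduleCat_exact_iff]
      intro (x : P ⟶ S.X₂) (hx : x ≫ S.g = 0)
      exact ⟨hS.exact.lift x hx, hS.exact.lift_f x hx⟩
    · intro (x : P ⟶ S.X₁) (y : P ⟶ S.X₁) (h : x ≫ S.f = y ≫ S.f)
      exact (cancel_mono S.f).1 h
    · intro (x : P ⟶ S.X₃)
      exact ⟨Projective.factorThru x S.g, Projective.factorThru_comp x S.g⟩
  exact hT.op

/-- A short complex of functors is exact if it is exact after evaluation at all objects. -/
lemma exact_of_evaluation {J : Type*} [Category* J] {D : Type*} [Category* D] [Abelian D]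
    (S : ShortComplex (J ⥤ D)) (h : ∀ j, (S.map ((evaluation J D).obj j)).Exact) : S.Exact := by
  rw [ShortComplex.exact_iff_isZero_homology]
  refine Functor.isZero _ fun j => ?_
  exact ((ShortComplex.exact_iff_isZero_homology _).1 (h j)).of_iso
    (S.mapHomologyIso ((evaluation J D).obj j)).symm

variable [EnoughProjectives C]

lemma exists_Ext_connecting {S : ShortComplex C} (hS : S.ShortExact) (n : ℕ) :
    ∃ δ : (Ext R C n).flip.obj S.X₃ ⟶ (Ext R C (n + 1)).flip.obj S.X₁,
      (∀ X, ∃ w, (ShortComplex.mk (((Ext R C n).flip.map S.g).app X) (δ.app X) w).Exact) ∧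
      (∀ X, ∃ w, (ShortComplex.mk (δ.app X)
        (((Ext R C (n + 1)).flip.map S.f).app X) w).Exact) := by
  obtain ⟨δ, h₁, h₂⟩ := exists_leftDerived_connecting (shortExactOnProjectives_linearYoneda R hS) n
  refine ⟨NatTrans.leftOp δ, fun X => ?_, fun X => ?_⟩
  · obtain ⟨w, h⟩ := h₂ X.unop
    exact ⟨congrArg Quiver.Hom.unop w, h.unop⟩
  · obtain ⟨w, h⟩ := h₁ X.unop
    exact ⟨congrArg Quiver.Hom.unop w, h.unop⟩

end CategoryTheory

namespace localCohomology

variable {R : Type u} [CommRing R]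

/-- The diagram of `Ext` modules whose colimit is the local cohomology of `M`. -/
abbrev extDiagram (J : Ideal R) (i : ℕ) (M : ModuleCat.{u} R) : ℕᵒᵖᵒᵖ ⥤ ModuleCat.{u} R :=
  (ringModIdeals (idealPowersDiagram J)).op ⋙ (Ext R (ModuleCat.{u} R) i).flip.obj M

/-- The colimit cocone exhibiting local cohomology as a colimit of `Ext` modules. -/
def cocone (J : Ideal R) (i : ℕ) (M : ModuleCat.{u} R) : Cocone (extDiagram J i M) :=
  ((evaluation _ _).obj M).mapCocone (colimit.cocone (diagram (idealPowersDiagram J) i))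

/-- Local cohomology is the colimit of `Ext` modules. -/
def isColimitCocone (J : Ideal R) (i : ℕ) (M : ModuleCat.{u} R) : IsColimit (cocone J i M) :=
  isColimitOfPreserves ((evaluation _ _).obj M)
    (colimit.isColimit (diagram (idealPowersDiagram J) i))

/-- The inclusion of `Ext` into local cohomology. -/
def ι (J : Ideal R) (i : ℕ) (M : ModuleCat.{u} R) (n : ℕᵒᵖᵒᵖ) :
    (extDiagram J i M).obj n ⟶ (localCohomology J i).obj M :=
  (cocone J i M).ι.app n

lemma ι_map (J : Ideal R) (i : ℕ) {M N : ModuleCat.{u} R} (f : M ⟶ N) (n : ℕᵒᵖᵒᵖ) :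
    ι J i M n ≫ (localCohomology J i).map f =
      ((Ext R (ModuleCat.{u} R) i).flip.map f).app _ ≫ ι J i N n :=
  ((colimit.ι (diagram (idealPowersDiagram J) i) n).naturality f).symm

lemma exists_connecting (J : Ideal R) {S : ShortComplex (ModuleCat.{u} R)}
    (hS : S.ShortExact) (i : ℕ) :
    ∃ δ : (localCohomology J i).obj S.X₃ ⟶ (localCohomology J (i + 1)).obj S.X₁,
      (∃ w, (ShortComplex.mk ((localCohomology J i).map S.g) δ w).Exact) ∧
      (∃ w, (ShortComplex.mk δ ((localCohomology J (i + 1)).map S.f) w).Exact) := by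
  have : AB5OfSize.{0, 0} (ModuleCat.{u} R) := AB5OfSize_of_univLE.{0, 0, u, u} _
  have : HasExactColimitsOfShape ℕᵒᵖᵒᵖ (ModuleCat.{u} R) := AB5OfSize.ofShape _
  obtain ⟨δ, h₁, h₂⟩ := exists_Ext_connecting R hS i
  let D := (ringModIdeals (idealPowersDiagram J)).op
  let f := Functor.whiskerLeft D ((Ext R (ModuleCat.{u} R) i).flip.map S.g)
  let g := Functor.whiskerLeft D δ
  let h := Functor.whiskerLeft D ((Ext R (ModuleCat.{u} R) (i + 1)).flip.map S.f)
  have w₁ : f ≫ g = 0 := by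
    ext n : 2
    exact (h₁ _).1
  have w₂ : g ≫ h = 0 := by
    ext n : 2
    exact (h₂ _).1
  have e₁ : (ShortComplex.mk f g w₁).Exact := by
    refine exact_of_evaluation _ fun n => (h₁ _).2
  have e₂ : (ShortComplex.mk g h w₂).Exact := by
    refine exact_of_evaluation _ fun n => (h₂ _).2
  let d : (localCohomology J i).obj S.X₃ ⟶ (localCohomology J (i + 1)).obj S.X₁ :=
    (isColimitCocone J i S.X₃).desc ((Cocone.precompose g).obj (cocone J (i + 1) S.X₁))
  have hd (n) : ι J i S.X₃ n ≫ d = g.app n ≫ ι J (i + 1) S.X₁ n :=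
    (isColimitCocone J i S.X₃).fac _ _
  refine ⟨d, ⟨_, colim.exact_mapShortComplex e₁ (isColimitCocone J i S.X₂)
    (isColimitCocone J i S.X₃) (isColimitCocone J (i + 1) S.X₁) _ d
    (fun n => ι_map J i S.g n) hd⟩, ⟨_, colim.exact_mapShortComplex e₂ (isColimitCocone J i S.X₃)
    (isColimitCocone J (i + 1) S.X₁) (isColimitCocone J (i + 1) S.X₂) d _ hd
    (fun n => ι_map J (i + 1) S.f n)⟩⟩

end localCohomology

namespace CategoryTheory

section
variable {A : Type u} [Category.{v} A] [Abelian A] [EnoughProjectives A]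
  {B : Type u'} [Category.{v'} B] [Abelian B]

lemma leftDerived_comp_fromLeftDerivedZero {F G : A ⥤ B} [F.Additive] [G.Additive] (α : F ⟶ G) :
    NatTrans.leftDerived α 0 ≫ G.fromLeftDerivedZero = F.fromLeftDerivedZero ≫ α := by
  ext X
  let P := projectiveResolution X
  let K : ChainComplex B ℕ := (F.mapHomologicalComplex _).obj P.complex
  let L : ChainComplex B ℕ := (G.mapHomologicalComplex _).obj P.complex
  let φ : K ⟶ L := (NatTrans.mapHomologicalComplex α _).app P.complex
  let a : K.opcycles 0 ⟶ F.obj X := P.fromLeftDerivedZero' F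
  let b : L.opcycles 0 ⟶ G.obj X := P.fromLeftDerivedZero' G
  have ha : K.pOpcycles 0 ≫ a = F.map (P.π.f 0) := P.pOpcycles_comp_fromLeftDerivedZero' F
  have hb : L.pOpcycles 0 ≫ b = G.map (P.π.f 0) := P.pOpcycles_comp_fromLeftDerivedZero' G
  have h : HomologicalComplex.opcyclesMap φ 0 ≫ b = a ≫ α.app X := by
    rw [← cancel_epi (K.pOpcycles 0), HomologicalComplex.p_opcyclesMap_assoc, hb, ← Category.assoc,
      ha]
    exact (α.naturality (P.π.f 0)).symm
  have h' : HomologicalComplex.homologyMap φ 0 ≫ L.isoHomologyι₀.hom ≫ b =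
      K.isoHomologyι₀.hom ≫ a ≫ α.app X := by
    rw [← h]
    exact HomologicalComplex.homologyι_naturality_assoc φ 0 b
  let e : (F.leftDerived 0).obj X ≅ K.homology 0 := P.isoLeftDerivedObj F 0
  let e' : (G.leftDerived 0).obj X ≅ L.homology 0 := P.isoLeftDerivedObj G 0
  have hα : (NatTrans.leftDerived α 0).app X = e.hom ≫ HomologicalComplex.homologyMap φ 0 ≫ e'.inv :=
    P.leftDerived_app_eq α 0
  have hF : F.fromLeftDerivedZero.app X = e.hom ≫ K.isoHomologyι₀.hom ≫ a :=
    (P.fromLeftDerivedZero_eq F)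
  have hG : G.fromLeftDerivedZero.app X = e'.hom ≫ L.isoHomologyι₀.hom ≫ b :=
    (P.fromLeftDerivedZero_eq G)
  rw [NatTrans.comp_app, NatTrans.comp_app, hα, hF, hG]
  simp only [Category.assoc, Iso.inv_hom_id_assoc]
  rw [h']

end

variable {C : Type u} [Category.{v} C] [Abelian C] (R : Type u') [Ring R] [Linear R C]
  [EnoughProjectives C]

instance (M : C) : PreservesFiniteColimits ((linearYoneda R C).obj M).rightOp := by
  have : PreservesFiniteLimits ((linearYoneda R C).obj M) := by
    have : PreservesFiniteLimits ((linearYoneda R C).obj M ⋙ forget (ModuleCat.{v} R)) :=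
      inferInstanceAs (PreservesFiniteLimits (yoneda.obj M))
    exact preservesFiniteLimits_of_reflects_of_preserves _ (forget (ModuleCat.{v} R))
  exact preservesFiniteColimits_rightOp _

variable (C) in
/-- `Ext⁰` is naturally isomorphic to `Hom`. -/
def extZeroIso : (Ext R C 0).flip ≅ linearYoneda R C :=
  (NatIso.ofComponents (fun M =>
      NatIso.ofComponents (fun X => (asIso
        (((linearYoneda R C).obj M).rightOp.fromLeftDerivedZero.app X.unop)).unop)
        (fun f => congrArg Quiver.Hom.unop
          (((linearYoneda R C).obj M).rightOp.fromLeftDerivedZero.naturality f.unop).symm))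
      (fun {M N} f => by
        ext X : 2
        exact congrArg (fun t => (t.app X.unop).unop)
          (leftDerived_comp_fromLeftDerivedZero
            (NatTrans.rightOp ((linearYoneda R C).map f))).symm) :
    linearYoneda R C ≅ (Ext R C 0).flip).symm
lemma isZero_Ext_succ_of_injective (X E : C) [Injective E] (n : ℕ) :
    IsZero (((Ext R C (n + 1)).obj (op X)).obj E) := by
  let P := projectiveResolution X
  refine IsZero.of_iso ?_ (P.isoExt (n + 1) E)
  rw [← HomologicalComplex.exactAt_iff_isZero_homology,
    HomologicalComplex.exactAt_iff' _ n (n + 1) (n + 2) (by simp) (by simp),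
    ShortComplex.moduleCat_exact_iff]
  intro (x : P.complex.X (n + 1) ⟶ E) (hx : P.complex.d (n + 2) (n + 1) ≫ x = 0)
  have hP := P.exact_succ n
  exact ⟨hP.descToInjective x hx, hP.comp_descToInjective x hx⟩

end CategoryTheory

namespace localCohomology

variable {R : Type u} [CommRing R]

lemma isZero_succ_of_injective (J : Ideal R) (E : ModuleCat.{u} R) [Injective E] (n : ℕ) :
    IsZero ((localCohomology J (n + 1)).obj E) := by
  rw [IsZero.iff_id_eq_zero]
  exact (isColimitCocone J (n + 1) E).hom_ext fun j =>
    (isZero_Ext_succ_of_injective R _ E n).eq_of_src _ _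

/-- Evaluation of homomorphisms out of `R ⧸ I` at the class of `1`. -/
def evalOne (I : Ideal R) (M : ModuleCat.{u} R) :
    ((linearYoneda R (ModuleCat.{u} R)).obj M).obj (op (ModuleCat.of R (R ⧸ I))) ⟶ M :=
  ModuleCat.ofHom (X := ((linearYoneda R (ModuleCat.{u} R)).obj M).obj
      (op (ModuleCat.of R (R ⧸ I))))
    { toFun := fun f => f.hom (Submodule.Quotient.mk 1)
      map_add' := fun _ _ => rfl
      map_smul' := fun _ _ => rfl }

lemma evalOne_injective (I : Ideal R) (M : ModuleCat.{u} R) :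
    Function.Injective (evalOne I M) := by
  intro (f : ModuleCat.of R (R ⧸ I) ⟶ M) (g : ModuleCat.of R (R ⧸ I) ⟶ M)
    (h : f.hom (Submodule.Quotient.mk 1) = g.hom (Submodule.Quotient.mk 1))
  refine ModuleCat.hom_ext (Submodule.linearMap_qext _ (LinearMap.ext_ring h))

lemma mem_range_evalOne (I : Ideal R) (M : ModuleCat.{u} R) (x : M) :
    x ∈ Set.range (evalOne I M) ↔ ∀ r ∈ I, r • x = 0 := by
  constructor
  · rintro ⟨f : ModuleCat.of R (R ⧸ I) ⟶ M, rfl⟩ r hr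
    change r • f.hom (Submodule.Quotient.mk 1) = 0
    rw [← map_smul, ← Submodule.Quotient.mk_smul, smul_eq_mul, mul_one,
      (Submodule.Quotient.mk_eq_zero I).2 hr, map_zero]
  · intro h
    let f : ModuleCat.of R (R ⧸ I) ⟶ M :=
      ModuleCat.ofHom (Submodule.liftQ I (LinearMap.toSpanSingleton R M x) h)
    exact ⟨f, one_smul R x⟩

/-- The evaluation at `1` of the degree zero extension group of `R ⧸ J ^ n`. -/
def extZeroEval (J : Ideal R) (M : ModuleCat.{u} R) (n : ℕᵒᵖᵒᵖ) :
    (extDiagram J 0 M).obj n ⟶ M :=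
  ((extZeroIso (ModuleCat.{u} R) R).hom.app M).app _ ≫ evalOne (J ^ n.unop.unop) M

lemma extDiagram_map_extZeroEval (J : Ideal R) (M : ModuleCat.{u} R) {m n : ℕᵒᵖᵒᵖ} (f : m ⟶ n) :
    (extDiagram J 0 M).map f ≫ extZeroEval J M n = extZeroEval J M m := by
  have h := ((extZeroIso (ModuleCat.{u} R) R).hom.app M).naturality
    ((ringModIdeals (idealPowersDiagram J)).op.map f)
  exact (Category.assoc _ _ _).symm.trans ((congrArg (· ≫ evalOne (J ^ n.unop.unop) M) h).trans rfl)

lemma extZeroEval_naturality (J : Ideal R) {M N : ModuleCat.{u} R} (f : M ⟶ N) (n : ℕᵒᵖᵒᵖ) :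
    ((Ext R (ModuleCat.{u} R) 0).flip.map f).app _ ≫ extZeroEval J N n =
      extZeroEval J M n ≫ f := by
  have h := congrArg (fun t => t.app ((ringModIdeals (idealPowersDiagram J)).op.obj n))
    ((extZeroIso (ModuleCat.{u} R) R).hom.naturality f)
  exact (Category.assoc _ _ _).symm.trans ((congrArg (· ≫ evalOne (J ^ n.unop.unop) N) h).trans rfl)

lemma exists_zero_to_id (J : Ideal R) :
    ∃ ε : localCohomology J 0 ⟶ 𝟭 (ModuleCat.{u} R), ∀ M : ModuleCat.{u} R,
      Function.Injective (ε.app M) ∧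
      ∀ x : M, x ∈ Set.range (ε.app M) ↔ ∃ n : ℕ, ∀ r ∈ J ^ n, r • x = 0 := by
  have := preservesSmallestFilteredColimits_of_preservesFilteredColimits
    (forget (ModuleCat.{u} R))
  have : PreservesColimitsOfShape ℕᵒᵖᵒᵖ (forget (ModuleCat.{u} R)) :=
    PreservesFilteredColimitsOfSize.preserves_filtered_colimits _
  let c (M : ModuleCat.{u} R) : Cocone (extDiagram J 0 M) :=
    { pt := M
      ι :=
      { app := extZeroEval J M
        naturality := fun m n f =>
          (extDiagram_map_extZeroEval J M f).trans (Category.comp_id _).symm } }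
  let ε (M : ModuleCat.{u} R) : (localCohomology J 0).obj M ⟶ M :=
    (isColimitCocone J 0 M).desc (c M)
  have hε (M n) : ι J 0 M n ≫ ε M = extZeroEval J M n := (isColimitCocone J 0 M).fac _ _
  have hε' (M n y) : ε M (ι J 0 M n y) = extZeroEval J M n y := congr($(hε M n) y)
  have hrep (M : ModuleCat.{u} R) (z : (localCohomology J 0).obj M) : ∃ n y, ι J 0 M n y = z :=
    Concrete.isColimit_exists_rep _ (isColimitCocone J 0 M) z
  refine ⟨{ app := ε, naturality := fun M N f => ?_ }, fun M => ⟨?_, fun x => ⟨?_, ?_⟩⟩⟩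
  · refine (isColimitCocone J 0 M).hom_ext fun n => ?_
    exact (Category.assoc _ _ _).symm.trans ((congrArg (· ≫ ε N) (ι_map J 0 f n)).trans
      ((Category.assoc _ _ _).trans ((congrArg (_ ≫ ·) (hε N n)).trans
        ((extZeroEval_naturality J f n).trans ((congrArg (· ≫ f) (hε M n)).symm.trans
          (Category.assoc _ _ _))))))
  · refine (injective_iff_map_eq_zero (ε M).hom).2 fun z hz => ?_
    obtain ⟨n, y, rfl⟩ := hrep M z
    have h : extZeroEval J M n y = 0 := (hε' M n y).symm.trans hz
    have h₂ : Function.Injective (extZeroEval J M n) := (evalOne_injective _ M).comp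
      (ConcreteCategory.bijective_of_isIso
        (((extZeroIso (ModuleCat.{u} R) R).hom.app M).app _)).1
    rw [h₂ (h.trans (map_zero (extZeroEval J M n).hom).symm), map_zero]
  · rintro ⟨z, rfl⟩
    obtain ⟨n, y, rfl⟩ := hrep M z
    refine ⟨n.unop.unop, (mem_range_evalOne _ M _).1 ⟨_, (hε' M n y).symm⟩⟩
  · rintro ⟨n, hn⟩
    obtain ⟨y, rfl⟩ := (mem_range_evalOne (J ^ n) M x).2 hn
    obtain ⟨z, rfl⟩ := (ConcreteCategory.bijective_of_isIso
      (((extZeroIso (ModuleCat.{u} R) R).hom.app M).app _)).2 y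
    exact ⟨ι J 0 M (op (op n)) z, hε' M (op (op n)) z⟩

end localCohomology

lemma Module.Injective.exists_comp_eq {S : Type u} [CommRing S] {M N E : Type u}
    [AddCommGroup M] [Module S M] [AddCommGroup N] [Module S N] [AddCommGroup E] [Module S E]
    [Module.Injective S E] (h : M →ₗ[S] N) (x : M →ₗ[S] E)
    (hx : LinearMap.ker h ≤ LinearMap.ker x) : ∃ y : N →ₗ[S] E, y ∘ₗ h = x := by
  obtain ⟨y, hy⟩ := Module.Injective.out ((LinearMap.ker h).liftQ h le_rfl)
    (LinearMap.ker_eq_bot.1 (Submodule.ker_liftQ_eq_bot _ _ _ le_rfl)) ((LinearMap.ker h).liftQ x hx)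
  exact ⟨y, LinearMap.ext fun m => hy (Submodule.Quotient.mk m)⟩

/-- Over a Noetherian ring, a torsion homomorphism from a submodule of a finite module to an
injective module extends to a torsion homomorphism. -/
lemma Module.Injective.exists_torsion_extension {S : Type u} [CommRing S] [IsNoetherianRing S]
    (J : Ideal S) {F E : Type u} [AddCommGroup F] [Module S F] [Module.Finite S F]
    [AddCommGroup E] [Module S E] [Module.Injective S E] (L : Submodule S F) (x : L →ₗ[S] E) (n : ℕ)
    (hx : ∀ r ∈ J ^ n, r • x = 0) :
    ∃ y : F →ₗ[S] E, y ∘ₗ L.subtype = x ∧ ∃ m : ℕ, ∀ r ∈ J ^ m, r • y = 0 := by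
  obtain ⟨k, hk⟩ := J.exists_pow_inf_eq_pow_smul L
  have hker : J ^ n • L ≤ (LinearMap.ker x).map L.subtype := by
    refine Submodule.smul_le.2 fun r hr l hl => ⟨r • ⟨l, hl⟩, ?_, rfl⟩
    exact (map_smul x r ⟨l, hl⟩).trans (LinearMap.congr_fun (hx r hr) ⟨l, hl⟩)
  obtain ⟨y, hy⟩ := Module.Injective.exists_comp_eq
    ((J ^ (n + k) • (⊤ : Submodule S F)).mkQ ∘ₗ L.subtype) x fun l hl => by
      have hl' : (l : F) ∈ J ^ (n + k) • (⊤ : Submodule S F) :=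
        (Submodule.Quotient.mk_eq_zero _).1 hl
      have h := hk (n + k) (Nat.le_add_left _ _) ▸ Submodule.mem_inf.2 ⟨hl', l.2⟩
      rw [Nat.add_sub_cancel] at h
      obtain ⟨l', h₁, h₂⟩ := hker (Submodule.smul_mono le_rfl inf_le_right h)
      rwa [← show l' = l from Subtype.ext h₂]
  refine ⟨y ∘ₗ Submodule.mkQ _, hy, n + k, fun r hr => LinearMap.ext fun v => ?_⟩
  have : (J ^ (n + k) • (⊤ : Submodule S F)).mkQ (r • v) = 0 :=
    (Submodule.Quotient.mk_eq_zero _).2 (Submodule.smul_mem_smul hr trivial)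
  rw [LinearMap.smul_apply, ← map_smul, LinearMap.comp_apply, this, map_zero, LinearMap.zero_apply]

namespace localCohomology

lemma isZero_succ_linearMap_of_injective {S : Type u} [CommRing S] [IsNoetherianRing S]
    (J : Ideal S) (E : Type u) [AddCommGroup E] [Module S E] [Module.Injective S E] (i : ℕ)
    (L : Type u) [AddCommGroup L] [Module S L] [Module.Finite S L] :
    IsZero ((localCohomology J (i + 1)).obj (ModuleCat.of S (L →ₗ[S] E))) := by
  induction i using Nat.strong_induction_on generalizing L with | _ i ih
  obtain ⟨k, π, hπ⟩ := Module.Finite.exists_fin' S L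
  let F := Fin k → S
  let T : ShortComplex (ModuleCat.{u} S) :=
    .mk (X₁ := ModuleCat.of S (L →ₗ[S] E)) (X₂ := ModuleCat.of S (F →ₗ[S] E))
      (X₃ := ModuleCat.of S (LinearMap.ker π →ₗ[S] E))
      (ModuleCat.ofHom (LinearMap.lcomp S E π))
      (ModuleCat.ofHom (LinearMap.lcomp S E (LinearMap.ker π).subtype)) (by
        ext x v
        exact (congrArg x v.2).trans (map_zero x))
  have hT : T.ShortExact := by
    refine ModuleCat.shortComplex_shortExact T (fun (x : F →ₗ[S] E) => ⟨fun hx => ?_, ?_⟩) ?_ ?_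
    · have hx' : LinearMap.ker π ≤ LinearMap.ker x :=
        fun v hv => LinearMap.congr_fun hx ⟨v, hv⟩
      refine ⟨(LinearMap.ker π).liftQ x hx' ∘ₗ
        (π.quotKerEquivOfSurjective hπ).symm.toLinearMap, LinearMap.ext fun v => ?_⟩
      have h : (π.quotKerEquivOfSurjective hπ).symm (π v) = Submodule.Quotient.mk v :=
        (LinearEquiv.symm_apply_eq _).2 rfl
      exact congrArg ((LinearMap.ker π).liftQ x hx') h
    · rintro ⟨x, rfl⟩
      exact congr($(T.zero) x)
    · exact fun x y h => (LinearMap.cancel_right hπ).1 h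
    · intro (x : LinearMap.ker π →ₗ[S] E)
      exact Module.Injective.exists_comp_eq (LinearMap.ker π).subtype x
        (by rw [Submodule.ker_subtype]; exact bot_le)
  have : Injective T.X₂ := by
    refine Injective.of_iso (P := ModuleCat.of S (Fin k → E))
      (LinearEquiv.piRing S E (Fin k) S).symm.toModuleIso
      ((Module.injective_iff_injective_object S (Fin k → E)).1 inferInstance)
  obtain ⟨δ, ⟨w, h₁⟩, ⟨w', h₂⟩⟩ := exists_connecting J hT i
  have : Epi δ := h₂.epi_f ((isZero_succ_of_injective J T.X₂ i).eq_zero_of_tgt _)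
  refine IsZero.of_epi_eq_zero δ ?_
  rcases i with _ | i
  · obtain ⟨ε, hε⟩ := exists_zero_to_id J
    have : Epi ((localCohomology J 0).map T.g) := by
      rw [ModuleCat.epi_iff_surjective]
      intro z
      obtain ⟨n, hn⟩ := ((hε T.X₃).2 (ε.app T.X₃ z)).1 ⟨z, rfl⟩
      obtain ⟨y, hy, hm⟩ := Module.Injective.exists_torsion_extension J (LinearMap.ker π)
        (show LinearMap.ker π →ₗ[S] E from ε.app T.X₃ z) n hn
      obtain ⟨t, ht⟩ := ((hε T.X₂).2 y).2 hm
      refine ⟨t, (hε T.X₃).1 ?_⟩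
      exact (congr($(ε.naturality T.g) t)).trans ((congrArg T.g ht).trans hy)
    exact zero_of_epi_comp _ w
  · exact (ih i (Nat.lt_succ_self i) (LinearMap.ker π)).eq_zero_of_src _

end localCohomology

namespace CategoryTheory.ShortComplex

lemma Exact.nonempty_iso_of_epi {C : Type u} [Category.{v} C] [Abelian C] {S T : ShortComplex C}
    (hS : S.Exact) (hT : T.Exact) [Epi S.g] [Epi T.g] (e₁ : S.X₁ ≅ T.X₁) (e₂ : S.X₂ ≅ T.X₂)
    (h : e₁.hom ≫ T.f = S.f ≫ e₂.hom) : Nonempty (S.X₃ ≅ T.X₃) :=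
  ⟨CokernelCofork.mapIsoOfIsColimit hS.gIsCokernel hT.gIsCokernel (Arrow.isoMk e₁ e₂ h)⟩

end CategoryTheory.ShortComplex

namespace localCohomology

variable {S R : Type u} [CommRing S] [CommRing R] (f : S →+* R)

instance : (ModuleCat.restrictScalars.{u} f).PreservesHomology := by
  have : PreservesColimitsOfSize.{0, 0} (ModuleCat.restrictScalars.{u} f) :=
    (ModuleCat.restrictCoextendScalarsAdj.{u} f).leftAdjoint_preservesColimits
  have : PreservesLimitsOfSize.{0, 0} (ModuleCat.restrictScalars.{u} f) :=
    (ModuleCat.extendRestrictScalarsAdj.{u} f).rightAdjoint_preservesLimits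
  have : PreservesFiniteLimits (ModuleCat.restrictScalars.{u} f) :=
    PreservesLimitsOfSize.preservesFiniteLimits _
  have : PreservesFiniteColimits (ModuleCat.restrictScalars.{u} f) :=
    PreservesColimitsOfSize.preservesFiniteColimits _
  infer_instance

/-- Torsion with respect to an ideal commutes with restriction of scalars along a surjection. -/
lemma nonempty_zero_restrictScalars_iso (hf : Function.Surjective f) (b : Ideal S) :
    Nonempty (ModuleCat.restrictScalars.{u} f ⋙ localCohomology b 0 ≅
      localCohomology (b.map f) 0 ⋙ ModuleCat.restrictScalars.{u} f) := by
  obtain ⟨ε, hε⟩ := exists_zero_to_id b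
  obtain ⟨ε', hε'⟩ := exists_zero_to_id (b.map f)
  let res := ModuleCat.restrictScalars.{u} f
  let φ (N : ModuleCat.{u} R) : (localCohomology b 0).obj (res.obj N) ⟶ res.obj N :=
    ε.app (res.obj N)
  let ψ (N : ModuleCat.{u} R) : res.obj ((localCohomology (b.map f) 0).obj N) ⟶ res.obj N :=
    res.map (ε'.app N)
  have hφ (N) : Function.Injective (φ N).hom := (hε (res.obj N)).1
  have hψ (N) : Function.Injective (ψ N).hom := (hε' N).1
  have hrange (N) : LinearMap.range (φ N).hom = LinearMap.range (ψ N).hom := by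
    ext (x : N)
    refine ((hε (res.obj N)).2 x).trans (Iff.trans ?_ ((hε' N).2 x).symm)
    refine exists_congr fun n => ?_
    rw [← Ideal.map_pow]
    refine ⟨fun h r hr => ?_, fun h s hs => h (f s) (Ideal.mem_map_of_mem f hs)⟩
    obtain ⟨s, hs, rfl⟩ := (Ideal.mem_map_iff_of_surjective f hf).1 hr
    exact h s hs
  let e (N) := ((LinearEquiv.ofInjective _ (hφ N)).trans (LinearEquiv.ofEq _ _ (hrange N))).trans
    (LinearEquiv.ofInjective _ (hψ N)).symm
  have he (N) : (e N).toModuleIso.hom ≫ ψ N = φ N := by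
    ext x
    exact congrArg Subtype.val ((LinearEquiv.ofInjective _ (hψ N)).apply_symm_apply _)
  refine ⟨NatIso.ofComponents (fun N => (e N).toModuleIso) fun {M N} g => ?_⟩
  have : Mono (ψ N) := (ModuleCat.mono_iff_injective _).2 (hψ N)
  have h₁ : (localCohomology b 0).map (res.map g) ≫ φ N = φ M ≫ res.map g :=
    ε.naturality (res.map g)
  have h₂ : res.map ((localCohomology (b.map f) 0).map g) ≫ ψ N = ψ M ≫ res.map g := by
    rw [← res.map_comp, ← res.map_comp]
    exact congrArg res.map (ε'.naturality g)
  rw [← cancel_mono (ψ N)]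
  calc _ = (localCohomology b 0).map (res.map g) ≫ (e N).toModuleIso.hom ≫ ψ N :=
        Category.assoc _ _ _
    _ = (e M).toModuleIso.hom ≫ res.map ((localCohomology (b.map f) 0).map g) ≫ ψ N := by
        rw [he, h₁, h₂, ← Category.assoc, he]
    _ = _ := (Category.assoc _ _ _).symm

lemma isZero_succ_restrictScalars_coextendScalars [IsNoetherianRing S]
    (hf : Function.Surjective f) (b : Ideal S) (E : ModuleCat.{u} S) [Injective E] (i : ℕ) :
    IsZero ((localCohomology b (i + 1)).obj
      ((ModuleCat.restrictScalars f).obj ((ModuleCat.coextendScalars f).obj E))) := by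
  let L := (ModuleCat.restrictScalars f).obj (ModuleCat.of R R)
  have : Module.Finite S L := by
    refine Module.Finite.of_surjective (LinearMap.toSpanSingleton S L (1 : R)) fun r => ?_
    obtain ⟨s, rfl⟩ := hf r
    exact ⟨s, mul_one (f s)⟩
  have : Module.Injective S E := (Module.injective_iff_injective_object S E).2 inferInstance
  refine (isZero_succ_linearMap_of_injective b E i L).of_iso ((localCohomology b (i + 1)).mapIso ?_)
  let K := (ModuleCat.restrictScalars f).obj ((ModuleCat.coextendScalars f).obj E)
  let e : K ≃ₗ[S] (L →ₗ[S] E) :=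
    { toFun := fun g => ModuleCat.CoextendScalars.equiv f E g
      invFun := fun g => (ModuleCat.CoextendScalars.equiv f E).symm g
      left_inv := fun _ => rfl
      right_inv := fun _ => rfl
      map_add' := fun _ _ => rfl
      map_smul' := fun s (g : L →ₗ[S] E) => LinearMap.ext fun (x : L) =>
        (congrArg g (mul_comm (show R from x) (f s))).trans (map_smul g s x) }
  exact e.toModuleIso

/-- Independence of the base: local cohomology commutes with restriction of scalars along a
surjective homomorphism out of a Noetherian ring. -/
theorem nonempty_restrictScalars_iso [IsNoetherianRing S]
    (hf : Function.Surjective f) (b : Ideal S) (i : ℕ) (N : ModuleCat.{u} R) :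
    Nonempty ((localCohomology b i).obj ((ModuleCat.restrictScalars f).obj N) ≅
      (ModuleCat.restrictScalars f).obj ((localCohomology (b.map f) i).obj N)) := by
  let res := ModuleCat.restrictScalars.{u} f
  obtain ⟨e₀⟩ := nonempty_zero_restrictScalars_iso f hf b
  induction i generalizing N with
  | zero => exact ⟨e₀.app N⟩
  | succ i ih =>
    let E := Injective.under (res.obj N)
    let K := (ModuleCat.coextendScalars.{u} f).obj E
    let η : N ⟶ K :=
      ModuleCat.RestrictionCoextensionAdj.HomEquiv.fromRestriction f (Injective.ι (res.obj N))
    have hη : Mono η := by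
      rw [ModuleCat.mono_iff_injective]
      intro x y h
      refine (ModuleCat.mono_iff_injective (Injective.ι (res.obj N))).1 inferInstance ?_
      have h' := congrArg (fun k => ModuleCat.CoextendScalars.equiv f E k (1 : R)) h
      have h₁ (z : N) : ModuleCat.CoextendScalars.equiv f E (η z) (1 : R) =
          Injective.ι (res.obj N) z :=
        congrArg (Injective.ι (res.obj N)) (one_smul R z)
      exact (h₁ x).symm.trans (h'.trans (h₁ y))
    have hK : Injective K :=
      (ModuleCat.restrictCoextendScalarsAdj.{u} f).map_injective E inferInstance
    let T : ShortComplex (ModuleCat.{u} R) := .mk η (cokernel.π η) (cokernel.condition η)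
    have hT : T.ShortExact := { exact := ShortComplex.exact_cokernel η }
    obtain ⟨δ, ⟨w, h₁⟩, ⟨w', h₂⟩⟩ := exists_connecting b (hT.map_of_exact res) i
    obtain ⟨δ', ⟨v, h₁'⟩, ⟨v', h₂'⟩⟩ := exists_connecting (b.map f) hT i
    have : Epi δ := h₂.epi_f
      ((isZero_succ_restrictScalars_coextendScalars f hf b E i).eq_zero_of_tgt _)
    have : Epi δ' := h₂'.epi_f ((isZero_succ_of_injective (b.map f) K i).eq_zero_of_tgt _)
    have : Epi (((ShortComplex.mk _ δ' v).map res).g) := inferInstanceAs (Epi (res.map δ'))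
    cases i with
    | zero =>
      exact h₁.nonempty_iso_of_epi (h₁'.map res) (e₀.app K) (e₀.app _) (e₀.hom.naturality _).symm
    | succ i =>
      obtain ⟨e⟩ := ih (cokernel η)
      have h := isZero_succ_restrictScalars_coextendScalars f hf b E i
      exact h₁.nonempty_iso_of_epi (h₁'.map res)
        (h.iso (res.map_isZero (isZero_succ_of_injective (b.map f) K i))) e (h.eq_of_src _ _)

end localCohomology

lemma isNoetherianRing_trivSqZeroExt (R : Type u) [CommRing R] [IsNoetherianRing R] (C : Type u)
    [AddCommGroup C] [Module R C] [Module Rᵐᵒᵖ C] [IsCentralScalar R C] [Module.Finite R C] :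
    IsNoetherianRing (TrivSqZeroExt R C) :=
  have : IsNoetherian R (TrivSqZeroExt R C) := inferInstanceAs (IsNoetherian R (R × C))
  isNoetherian_of_tower R this

lemma trivExtFst_surjective (R : Type u) [CommRing R] (C : Type u)
    [AddCommGroup C] [Module R C] [Module Rᵐᵒᵖ C] [IsCentralScalar R C] :
    Function.Surjective (trivExtFst R C) :=
  TrivSqZeroExt.fst_surjective

lemma map_trivExtFst_trivExtIdeal (R : Type u) [CommRing R] (a : Ideal R) (C : Type u)
    [AddCommGroup C] [Module R C] [Module Rᵐᵒᵖ C] [IsCentralScalar R C] :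
    (trivExtIdeal R a C).map (trivExtFst R C) = a :=
  Ideal.map_comap_of_surjective _ (trivExtFst_surjective R C) a

end

noncomputable section
open CategoryTheory TensorProduct

/-- If `R` is relative Cohen-Macaulay with respect to `a` and `C` is
semidualizing, then, viewing `R` as a module over `R ⋉ C` via the natural surjection,
`H_a^i(R) ≅ H_{a ⊕ C}^i(R)` as `R ⋉ C`-modules for all `i`, and `R` is relative
Cohen-Macaulay with respect to the ideal `a ⊕ C` of `R ⋉ C`. -/
theorem stmt_17 (R : Type u) [CommRing R] [IsNoetherianRing R] [IsLocalRing R]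
    (C : Type u) [AddCommGroup C] [Module R C] [Module Rᵐᵒᵖ C] [IsCentralScalar R C]
    (hC : IsSemidualizing R (ModuleCat.of R C))
    (a : Ideal R) (hRCM : IsRelativeCM R a (ModuleCat.of R R)) :
    (∀ i : ℕ, Nonempty
      ((↥((localCohomology (trivExtIdeal R a C) i).obj (trivExtModuleCat R C R)))
        ≃ₗ[TrivSqZeroExt R C]
       ↥(trivExtModuleCat R C ↥((localCohomology a i).obj (ModuleCat.of R R))))) ∧
    IsRelativeCM (TrivSqZeroExt R C) (trivExtIdeal R a C) (trivExtModuleCat R C R) := by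
  have : Module.Finite R C := hC.1
  have := isNoetherianRing_trivSqZeroExt R C
  have key (i : ℕ) : Nonempty
      ((↥((localCohomology (trivExtIdeal R a C) i).obj (trivExtModuleCat R C R)))
        ≃ₗ[TrivSqZeroExt R C]
       ↥(trivExtModuleCat R C ↥((localCohomology a i).obj (ModuleCat.of R R)))) := by
    obtain ⟨e⟩ := localCohomology.nonempty_restrictScalars_iso (trivExtFst R C)
      (trivExtFst_surjective R C) (trivExtIdeal R a C) i (ModuleCat.of R R)
    rw [map_trivExtFst_trivExtIdeal] at e
    exact ⟨e.toLinearEquiv⟩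
  refine ⟨key, (existsUnique_congr fun i => ?_).2 hRCM⟩
  exact (key i).some.toEquiv.nontrivial_congr

end
end

section
/- Let (R,m) be a Cohen-Macaulay local ring of Krull dimension d = 0 and let C be a semidualizing R-module. If C is C-injective (equivalently, if H_m^0(C) = C is C-injective), then R is Gorenstein. -/
noncomputable section
open CategoryTheory TensorProduct

/-- Two linear functionals with values in a field are proportional as soon as
`φ x * ψ y = u * (φ y * ψ x)`; if this holds for all pairs, the space is spanned by one vector. -/
theorem exists_span_singleton_of_dual_swap {k V : Type*} [Field k] [AddCommGroup V] [Module k V]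
    (u : k) (h : ∀ (φ ψ : V →ₗ[k] k) (x y : V), φ x * ψ y = u * (φ y * ψ x)) :
    ∃ v : V, ∀ w : V, ∃ c : k, w = c • v := by
  by_cases hV : ∀ v : V, v = 0
  · exact ⟨0, fun w => ⟨0, by rw [hV w, smul_zero]⟩⟩
  push Not at hV
  obtain ⟨v, hv⟩ := hV
  obtain ⟨φ, hφ⟩ : ∃ φ : V →ₗ[k] k, φ v ≠ 0 := by
    by_contra! H
    exact hv ((Module.forall_dual_apply_eq_zero_iff k v).1 H)
  refine ⟨v, fun w => ⟨φ w / φ v, ?_⟩⟩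
  rw [← sub_eq_zero, ← Module.forall_dual_apply_eq_zero_iff k]
  intro ψ
  have h1 := h φ ψ v (w - (φ w / φ v) • v)
  have h2 : φ (w - (φ w / φ v) • v) = 0 := by
    simp only [map_sub, map_smul, smul_eq_mul]
    field_simp
    ring
  rw [h2, zero_mul, mul_zero] at h1
  exact (mul_eq_zero.1 h1).resolve_left hφ

/-- If every endomorphism of `C` is a homothety and `C ≃ Hom(C, I)`, then some scalar `u`
relates each bilinear form on `C` with values in `I` to its flip. -/
theorem exists_forall_bilin_swap {S C I : Type*} [CommRing S] [AddCommGroup C] [Module S C]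
    [AddCommGroup I] [Module S I] (hC : Function.Surjective (LinearMap.lsmul S C))
    (e : C ≃ₗ[S] (C →ₗ[S] I)) :
    ∃ u : S, ∀ (g : C →ₗ[S] C →ₗ[S] I) (x y : C), g x y = u • g y x := by
  have key : ∀ g : C →ₗ[S] C →ₗ[S] I, ∃ r : S, ∀ x y, g x y = r • e x y := by
    intro g
    obtain ⟨r, hr⟩ := hC (e.symm.toLinearMap ∘ₗ g)
    refine ⟨r, fun x y => ?_⟩
    have hx : r • x = e.symm (g x) := LinearMap.congr_fun hr x
    rw [← e.apply_symm_apply (g x), ← hx, map_smul, LinearMap.smul_apply]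
  obtain ⟨u, hu⟩ := key e.toLinearMap.flip
  refine ⟨u, fun g x y => ?_⟩
  obtain ⟨r, hr⟩ := key g
  have hyx : e x y = u • e y x := hu y x
  rw [hr x y, hr y x, hyx, smul_comm]

/-- Over a zero-dimensional Noetherian local ring, the residue field embeds in every
nontrivial module. -/
theorem exists_residueField_embedding {S I : Type*} [CommRing S] [IsNoetherianRing S]
    [IsLocalRing S] [Ring.KrullDimLE 0 S] [AddCommGroup I] [Module S I] [Nontrivial I] :
    ∃ j : (S ⧸ IsLocalRing.maximalIdeal S) →ₗ[S] I, Function.Injective j := by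
  obtain ⟨p, hp⟩ := associatedPrimes.nonempty S I
  have hp' : IsAssociatedPrime p I := hp
  have : p.IsPrime := hp'.isPrime
  have hpm : p = IsLocalRing.maximalIdeal S := IsLocalRing.eq_maximalIdeal inferInstance
  obtain ⟨z, hz⟩ := ((isAssociatedPrime_iff).1 hp').2
  have hker : IsLocalRing.maximalIdeal S = LinearMap.ker (LinearMap.toSpanSingleton S I z) := by
    rw [← hpm, hz]
    ext r
    simp [Submodule.mem_colon_singleton]
  exact ⟨Submodule.liftQ _ _ hker.le, LinearMap.ker_eq_bot.1
    (Submodule.ker_liftQ_eq_bot _ _ _ hker.ge)⟩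

/-- Over a zero-dimensional Noetherian local ring, a finite module `C` all of whose endomorphisms
are homotheties and which is isomorphic to `Hom(C, I)` is cyclic. -/
theorem exists_generator_of_linearEquiv_hom {S C I : Type*} [CommRing S] [IsNoetherianRing S]
    [IsLocalRing S] [Ring.KrullDimLE 0 S] [AddCommGroup C] [Module S C] [Module.Finite S C]
    [AddCommGroup I] [Module S I] [Nontrivial I]
    (hC : Function.Surjective (LinearMap.lsmul S C)) (e : C ≃ₗ[S] (C →ₗ[S] I)) :
    ∃ x : C, Submodule.span S {x} = ⊤ := by
  set m := IsLocalRing.maximalIdeal S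
  let : Field (S ⧸ m) := Ideal.Quotient.field m
  obtain ⟨u, hu⟩ := exists_forall_bilin_swap hC e
  obtain ⟨j, hj⟩ := exists_residueField_embedding (S := S) (I := I)
  obtain ⟨v, hv⟩ := exists_span_singleton_of_dual_swap (k := S ⧸ m)
    (V := C ⧸ (m • ⊤ : Submodule S C)) (Ideal.Quotient.mk m u) (by
      intro φ ψ x y
      obtain ⟨x, rfl⟩ := Submodule.mkQ_surjective _ x
      obtain ⟨y, rfl⟩ := Submodule.mkQ_surjective _ y
      have h := hu (((LinearMap.mul S (S ⧸ m)).compl₁₂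
        (φ.restrictScalars S ∘ₗ Submodule.mkQ _)
        (ψ.restrictScalars S ∘ₗ Submodule.mkQ _)).compr₂ j) x y
      rw [LinearMap.compr₂_apply, LinearMap.compr₂_apply, ← j.map_smul] at h
      exact hj h)
  obtain ⟨x, rfl⟩ := Submodule.mkQ_surjective _ v
  refine ⟨x, top_le_iff.1 ?_⟩
  refine Submodule.le_of_le_smul_of_le_jacobson_bot (I := m) Module.Finite.fg_top
    (IsLocalRing.maximalIdeal_le_jacobson _) fun w _ => ?_
  obtain ⟨c, hc⟩ := hv (Submodule.mkQ _ w)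
  obtain ⟨r, rfl⟩ := Ideal.Quotient.mk_surjective c
  have hw : w - r • x ∈ (m • ⊤ : Submodule S C) := by
    rw [← Submodule.ker_mkQ (m • ⊤ : Submodule S C), LinearMap.mem_ker, map_sub, hc, map_smul]
    exact sub_self _
  exact Submodule.mem_sup.2 ⟨r • x, Submodule.smul_mem _ _ (Submodule.mem_span_singleton_self x),
    w - r • x, hw, by abel⟩

/-- If `R` is a zero-dimensional Cohen-Macaulay local ring and a
semidualizing module `C` is `C`-injective, then `R` is Gorenstein. -/
theorem stmt_18 (R : Type u) [CommRing R] [IsNoetherianRing R] [IsLocalRing R]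
    (hCM : IsCohenMacaulayLocalRing R) (hdim : ringKrullDim R = (0 : WithBot ℕ∞))
    (C : ModuleCat.{u} R) (hC : IsSemidualizing R C)
    (h : IsCInjective R C C) : IsGorensteinLocalRing R := by
  obtain ⟨hfin, ⟨hinj, hsurj⟩, -⟩ := hC
  obtain ⟨I, hI, ⟨e⟩⟩ := h
  have : Ring.KrullDimLE 0 R := by
    rw [Ring.krullDimLE_iff, hdim]
    exact le_rfl
  have : Nontrivial I := by
    by_contra hI'
    rw [not_nontrivial_iff_subsingleton] at hI'
    have hCs : Subsingleton C := e.toEquiv.subsingleton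
    exact one_ne_zero (α := R) (hinj (LinearMap.ext fun x => Subsingleton.elim _ _))
  obtain ⟨x, hx⟩ := exists_generator_of_linearEquiv_hom hsurj e
  have hbij : Function.Bijective (LinearMap.toSpanSingleton R C x) := by
    refine ⟨(injective_iff_map_eq_zero _).2 fun r hr => hinj (LinearMap.ext fun y => ?_),
      LinearMap.range_eq_top.1 (by rw [LinearMap.range_toSpanSingleton, hx])⟩
    obtain ⟨s, rfl⟩ := Submodule.mem_span_singleton.1 (hx ▸ Submodule.mem_top : y ∈ _)
    have hr' : r • x = 0 := hr
    simp [hr']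
  let f : R ≃ₗ[R] C := LinearEquiv.ofBijective _ hbij
  let g : I ≃ₗ[R] R :=
    ((f.trans e).trans (f.symm.congrLeft I R)).trans (LinearMap.ringLmapEquivSelf R R I) |>.symm
  have hR : Module.Injective R R :=
    Module.Baer.iff_injective.1 (Module.Baer.of_equiv g (Module.Baer.iff_injective.2 hI))
  have h0 : injDim R (ModuleCat.of R R) ≤ 0 := sInf_le ⟨0, rfl, Or.inr hR⟩
  exact ne_top_of_le_ne_top ENat.zero_ne_top h0

end
end
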